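/- There exists a countable nonstandard model M of PA and a set T ⊆ M such that (M,T) satisfies SeqInd but (M,T) does not satisfy SeqOInd. -/

import Mathlib

/- Abstract formalization of "Disjunctive correctness half-way"-style results on
   compositional truth over PA.  Models of PA are given by `PAStruct` together with
   `ModelOfPA` (full first-order induction via a deep embedding of L_PA-formulas).
   The internal (Gödel-coded, possibly nonstandard) syntax of a model is packaged in
   the structure `Coding`, whose fields are the arithmetically (Δ₀-)definable coding
   functions together with their basic PA-provable properties. -/

namespace CTPaper

/-- Terms of the arithmetical language L_PA = {0, S, +, ×}, variables indexed by ℕ. -/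
inductive Trm : Type
  | var : ℕ → Trm
  | zero : Trm
  | succ : Trm → Trm
  | add : Trm → Trm → Trm
  | mul : Trm → Trm → Trm

/-- First-order formulas of L_PA. -/
inductive Fml : Type
  | eq : Trm → Trm → Fml
  | not : Fml → Fml
  | or : Fml → Fml → Fml
  | and : Fml → Fml → Fml
  | ex : ℕ → Fml → Fml
  | all : ℕ → Fml → Fml

/-- Δ₀ (bounded) formulas of L_PA. -/
inductive Fml0 : Type
  | eq : Trm → Trm → Fml0
  | not : Fml0 → Fml0
  | or : Fml0 → Fml0 → Fml0
  | and : Fml0 → Fml0 → Fml0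
  | bex : ℕ → Trm → Fml0 → Fml0
  | ball : ℕ → Trm → Fml0 → Fml0

/-- Δ₀ (bounded) formulas of the language L_PA ∪ {T}, T a fresh unary predicate. -/
inductive TFml0 : Type
  | eq : Trm → Trm → TFml0
  | tr : Trm → TFml0
  | not : TFml0 → TFml0
  | or : TFml0 → TFml0 → TFml0
  | and : TFml0 → TFml0 → TFml0
  | bex : ℕ → Trm → TFml0 → TFml0
  | ball : ℕ → Trm → TFml0 → TFml0

/-- Formulas of the language L_PA ∪ {T}. -/
inductive TFml : Type
  | eq : Trm → Trm → TFml
  | tr : Trm → TFml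
  | not : TFml → TFml
  | or : TFml → TFml → TFml
  | and : TFml → TFml → TFml
  | ex : ℕ → TFml → TFml
  | all : ℕ → TFml → TFml

/-- Formulas of L_PA extended by a family of fresh unary predicates indexed by `P`. -/
inductive FmlX (P : Type) : Type
  | eq : Trm → Trm → FmlX P
  | pat : P → Trm → FmlX P
  | not : FmlX P → FmlX P
  | or : FmlX P → FmlX P → FmlX P
  | and : FmlX P → FmlX P → FmlX P
  | ex : ℕ → FmlX P → FmlX P
  | all : ℕ → FmlX P → FmlX P

def Trm.fv : Trm → Set ℕ
  | .var n => {n}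
  | .zero => ∅
  | .succ t => t.fv
  | .add t u => t.fv ∪ u.fv
  | .mul t u => t.fv ∪ u.fv

def Fml.fv : Fml → Set ℕ
  | .eq t u => t.fv ∪ u.fv
  | .not φ => φ.fv
  | .or φ ψ => φ.fv ∪ ψ.fv
  | .and φ ψ => φ.fv ∪ ψ.fv
  | .ex n φ => φ.fv \ {n}
  | .all n φ => φ.fv \ {n}

/-- An L_PA-sentence: a formula with no free variables. -/
def Fml.Closed (φ : Fml) : Prop := Fml.fv φ = ∅

/-- A structure for the language L_PA. -/
structure PAStruct where
  M : Type
  zero : M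
  succ : M → M
  add : M → M → M
  mul : M → M → M

def PAStruct.evalT (N : PAStruct) (v : ℕ → N.M) : Trm → N.M
  | .var n => v n
  | .zero => N.zero
  | .succ t => N.succ (N.evalT v t)
  | .add t u => N.add (N.evalT v t) (N.evalT v u)
  | .mul t u => N.mul (N.evalT v t) (N.evalT v u)

/-- The (definable) ordering of the model. -/
def PAStruct.le (N : PAStruct) (a b : N.M) : Prop := ∃ c, N.add a c = b

def PAStruct.lt (N : PAStruct) (a b : N.M) : Prop := N.le (N.succ a) b

/-- Tarskian satisfaction for L_PA-formulas. -/
def PAStruct.Sat (N : PAStruct) : (ℕ → N.M) → Fml → Prop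
  | v, .eq t u => N.evalT v t = N.evalT v u
  | v, .not φ => ¬ N.Sat v φ
  | v, .or φ ψ => N.Sat v φ ∨ N.Sat v ψ
  | v, .and φ ψ => N.Sat v φ ∧ N.Sat v ψ
  | v, .ex n φ => ∃ a, N.Sat (Function.update v n a) φ
  | v, .all n φ => ∀ a, N.Sat (Function.update v n a) φ

/-- Satisfaction for Δ₀ formulas of L_PA. -/
def PAStruct.Sat0 (N : PAStruct) : (ℕ → N.M) → Fml0 → Prop
  | v, .eq t u => N.evalT v t = N.evalT v u
  | v, .not φ => ¬ N.Sat0 v φ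
  | v, .or φ ψ => N.Sat0 v φ ∨ N.Sat0 v ψ
  | v, .and φ ψ => N.Sat0 v φ ∧ N.Sat0 v ψ
  | v, .bex n t φ => ∃ a, N.le a (N.evalT v t) ∧ N.Sat0 (Function.update v n a) φ
  | v, .ball n t φ => ∀ a, N.le a (N.evalT v t) → N.Sat0 (Function.update v n a) φ

/-- Satisfaction for Δ₀ formulas of L_PA ∪ {T}. -/
def PAStruct.SatT0 (N : PAStruct) (T : N.M → Prop) : (ℕ → N.M) → TFml0 → Prop
  | v, .eq t u => N.evalT v t = N.evalT v u
  | v, .tr t => T (N.evalT v t)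
  | v, .not φ => ¬ N.SatT0 T v φ
  | v, .or φ ψ => N.SatT0 T v φ ∨ N.SatT0 T v ψ
  | v, .and φ ψ => N.SatT0 T v φ ∧ N.SatT0 T v ψ
  | v, .bex n t φ => ∃ a, N.le a (N.evalT v t) ∧ N.SatT0 T (Function.update v n a) φ
  | v, .ball n t φ => ∀ a, N.le a (N.evalT v t) → N.SatT0 T (Function.update v n a) φ

/-- Satisfaction for formulas of L_PA ∪ {T}. -/
def PAStruct.SatT (N : PAStruct) (T : N.M → Prop) : (ℕ → N.M) → TFml → Prop
  | v, .eq t u => N.evalT v t = N.evalT v u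
  | v, .tr t => T (N.evalT v t)
  | v, .not φ => ¬ N.SatT T v φ
  | v, .or φ ψ => N.SatT T v φ ∨ N.SatT T v ψ
  | v, .and φ ψ => N.SatT T v φ ∧ N.SatT T v ψ
  | v, .ex n φ => ∃ a, N.SatT T (Function.update v n a) φ
  | v, .all n φ => ∀ a, N.SatT T (Function.update v n a) φ

/-- Satisfaction for formulas of L_PA extended by predicates indexed by `P`,
    interpreted by `I`. -/
def PAStruct.SatX (N : PAStruct) {P : Type} (I : P → N.M → Prop) : (ℕ → N.M) → FmlX P → Prop
  | v, .eq t u => N.evalT v t = N.evalT v u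
  | v, .pat p t => I p (N.evalT v t)
  | v, .not φ => ¬ N.SatX I v φ
  | v, .or φ ψ => N.SatX I v φ ∨ N.SatX I v ψ
  | v, .and φ ψ => N.SatX I v φ ∧ N.SatX I v ψ
  | v, .ex n φ => ∃ a, N.SatX I (Function.update v n a) φ
  | v, .all n φ => ∀ a, N.SatX I (Function.update v n a) φ

/-- `N` is a model of PA: the basic axioms for S, +, × and the full first-order
    induction scheme (with parameters) for L_PA-formulas. -/
def PAStruct.ModelOfPA (N : PAStruct) : Prop :=
  (∀ x, N.succ x ≠ N.zero) ∧
  (∀ x y, N.succ x = N.succ y → x = y) ∧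
  (∀ x, N.add x N.zero = x) ∧
  (∀ x y, N.add x (N.succ y) = N.succ (N.add x y)) ∧
  (∀ x, N.mul x N.zero = N.zero) ∧
  (∀ x y, N.mul x (N.succ y) = N.add (N.mul x y) x) ∧
  (∀ (φ : Fml) (n : ℕ) (v : ℕ → N.M),
    N.Sat (Function.update v n N.zero) φ →
    (∀ a, N.Sat (Function.update v n a) φ → N.Sat (Function.update v n (N.succ a)) φ) →
    ∀ a, N.Sat (Function.update v n a) φ)

/-- The interpretation of the numeral of `n`. -/
def PAStruct.std (N : PAStruct) : ℕ → N.M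
  | 0 => N.zero
  | n + 1 => N.succ (N.std n)

/-- `a` is a nonstandard element. -/
def PAStruct.Nonstd (N : PAStruct) (a : N.M) : Prop := ∀ n : ℕ, a ≠ N.std n

/-- `N` satisfies the sentence `φ`. -/
def PAStruct.SatSent (N : PAStruct) (φ : Fml) : Prop := ∀ v : ℕ → N.M, N.Sat v φ

/-- IΔ₀(T): the scheme of induction (with parameters) for Δ₀ formulas of L_PA ∪ {T}. -/
def Delta0Ind (N : PAStruct) (T : N.M → Prop) : Prop :=
  ∀ (φ : TFml0) (n : ℕ) (v : ℕ → N.M),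
    N.SatT0 T (Function.update v n N.zero) φ →
    (∀ a, N.SatT0 T (Function.update v n a) φ → N.SatT0 T (Function.update v n (N.succ a)) φ) →
    ∀ a, N.SatT0 T (Function.update v n a) φ

/-- The full induction scheme (with parameters) in the language L_PA expanded by the
    family of unary predicates indexed by `P` and interpreted by `I`. -/
def FullIndX (N : PAStruct) {P : Type} (I : P → N.M → Prop) : Prop :=
  ∀ (φ : FmlX P) (n : ℕ) (v : ℕ → N.M),
    N.SatX I (Function.update v n N.zero) φ →
    (∀ a, N.SatX I (Function.update v n a) φ → N.SatX I (Function.update v n (N.succ a)) φ) →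
    ∀ a, N.SatX I (Function.update v n a) φ

/-- Δ₀-definability of a unary predicate on `N`. -/
def Definable1 (N : PAStruct) (P : N.M → Prop) : Prop :=
  ∃ φ : Fml0, ∀ x : N.M, P x ↔ N.Sat0 (fun _ => x) φ

/-- Δ₀-definability of a binary relation on `N` (variable 0 ↦ x, others ↦ y). -/
def Definable2 (N : PAStruct) (P : N.M → N.M → Prop) : Prop :=
  ∃ φ : Fml0, ∀ x y : N.M, P x y ↔ N.Sat0 (fun n => if n = 0 then x else y) φ

/-- Δ₀-definability of a ternary relation on `N`. -/
def Definable3 (N : PAStruct) (P : N.M → N.M → N.M → Prop) : Prop :=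
  ∃ φ : Fml0, ∀ x y z : N.M,
    P x y z ↔ N.Sat0 (fun n => if n = 0 then x else if n = 1 then y else z) φ

/-- The internal (Gödel-coded) syntax of the model `N`: predicates distinguishing codes
    of variables, terms, formulas, sentences and coded finite sequences thereof, the
    basic syntactic operations on codes, assignments, the Δ₀ arithmetical truth
    predicate `Tr0`, propositional derivability, together with their basic
    (PA-provable) properties, including Δ₀-definability of the coding apparatus. -/
structure Coding (N : PAStruct) where
  Var' : N.M → Prop
  Trm' : N.M → Prop
  ClTrm' : N.M → Prop
  Fml' : N.M → Prop
  Fml1' : N.M → Prop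
  Sent' : N.M → Prop
  qfSent' : N.M → Prop
  FinSeq' : N.M → Prop
  SentSeq' : N.M → Prop
  FmlSeq' : N.M → Prop
  ClTrmSeq' : N.M → Prop
  lh : N.M → N.M
  app : N.M → N.M → N.M
  snoc : N.M → N.M → N.M
  concat : N.M → N.M → N.M
  negSeq : N.M → N.M
  val : N.M → N.M
  valSeq : N.M → N.M
  num : N.M → N.M
  eq' : N.M → N.M → N.M
  not' : N.M → N.M
  or' : N.M → N.M → N.M
  and' : N.M → N.M → N.M
  ex' : N.M → N.M → N.M
  all' : N.M → N.M → N.M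
  bigOr : N.M → N.M
  subst : N.M → N.M → N.M → N.M
  substSeq : N.M → N.M → N.M
  subst1 : N.M → N.M → N.M
  Asn : N.M → N.M → Prop
  substA : N.M → N.M → N.M
  evalA : N.M → N.M → N.M
  asnUpd : N.M → N.M → N.M → N.M
  asnExt : N.M → N.M → N.M → Prop
  emptyAsn : N.M
  freeIn : N.M → N.M → Prop
  Tr0 : N.M → Prop
  PrPropFrom : Set N.M → N.M → Prop
  sent_fml : ∀ x, Sent' x → Fml' x
  fml1_fml : ∀ x, Fml1' x → Fml' x
  qf_sent : ∀ x, qfSent' x → Sent' x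
  clt_trm : ∀ x, ClTrm' x → Trm' x
  num_cl : ∀ x, ClTrm' (num x)
  val_num : ∀ x, val (num x) = x
  sentSeq_iff : ∀ s, SentSeq' s ↔ (FinSeq' s ∧ ∀ i, N.lt i (lh s) → Sent' (app s i))
  fmlSeq_iff : ∀ s, FmlSeq' s ↔ (FinSeq' s ∧ ∀ i, N.lt i (lh s) → Fml' (app s i))
  snoc_fin : ∀ s x, FinSeq' s → FinSeq' (snoc s x)
  snoc_lh : ∀ s x, FinSeq' s → lh (snoc s x) = N.succ (lh s)
  snoc_app : ∀ s x i, FinSeq' s → N.lt i (lh s) → app (snoc s x) i = app s i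
  snoc_last : ∀ s x, FinSeq' s → app (snoc s x) (lh s) = x
  concat_fin : ∀ s t, FinSeq' s → FinSeq' t → FinSeq' (concat s t)
  concat_lh : ∀ s t, FinSeq' s → FinSeq' t → lh (concat s t) = N.add (lh s) (lh t)
  concat_app_l : ∀ s t i, FinSeq' s → FinSeq' t → N.lt i (lh s) → app (concat s t) i = app s i
  concat_app_r : ∀ s t i, FinSeq' s → FinSeq' t → N.lt i (lh t) →
    app (concat s t) (N.add (lh s) i) = app t i
  negSeq_seq : ∀ s, SentSeq' s → SentSeq' (negSeq s)
  negSeq_lh : ∀ s, SentSeq' s → lh (negSeq s) = lh s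
  negSeq_app : ∀ s i, SentSeq' s → N.lt i (lh s) → app (negSeq s) i = not' (app s i)
  sent_not : ∀ φ, Sent' φ → Sent' (not' φ)
  sent_or : ∀ φ ψ, Sent' φ → Sent' ψ → Sent' (or' φ ψ)
  sent_and : ∀ φ ψ, Sent' φ → Sent' ψ → Sent' (and' φ ψ)
  sent_eq : ∀ s t, ClTrm' s → ClTrm' t → Sent' (eq' s t)
  bigOr_sent : ∀ s, SentSeq' s → Sent' (bigOr s)
  bigOr_one : ∀ s, SentSeq' s → lh s = N.succ N.zero → bigOr s = app s N.zero
  bigOr_snoc : ∀ s ψ, SentSeq' s → N.lt N.zero (lh s) → Sent' ψ →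
    bigOr (snoc s ψ) = or' (bigOr s) ψ
  substA_sent : ∀ φ α, Fml' φ → Asn φ α → Sent' (substA φ α)
  emptyAsn_asn : ∀ φ, Sent' φ → Asn φ emptyAsn
  asnUpd_asn : ∀ φ α x v, Asn φ α → Asn φ (asnUpd α x v)
  df_sent : Definable1 N Sent'
  df_fin : Definable1 N FinSeq'
  df_lh : Definable2 N (fun s y => lh s = y)
  df_app : Definable3 N (fun s i y => app s i = y)
  df_bigOr : Definable2 N (fun s y => bigOr s = y)
  df_not : Definable2 N (fun x y => not' x = y)
  df_or : Definable3 N (fun x y z => or' x y = z)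
  df_num : Definable2 N (fun x y => num x = y)
  df_negSeq : Definable2 N (fun s y => negSeq s = y)
  df_snoc : Definable3 N (fun s x y => snoc s x = y)

/-- CT⁻: the compositional axioms (including the regularity axiom) for the truth
    predicate `T` over the model `N` with internal syntax `C`. -/
structure CTminus (N : PAStruct) (C : Coding N) (T : N.M → Prop) : Prop where
  tSent : ∀ x, T x → C.Sent' x
  tEq : ∀ s t, C.ClTrm' s → C.ClTrm' t → (T (C.eq' s t) ↔ C.val s = C.val t)
  tNot : ∀ φ, C.Sent' φ → (T (C.not' φ) ↔ ¬ T φ)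
  tOr : ∀ φ ψ, C.Sent' φ → C.Sent' ψ → (T (C.or' φ ψ) ↔ (T φ ∨ T ψ))
  tAnd : ∀ φ ψ, C.Sent' φ → C.Sent' ψ → (T (C.and' φ ψ) ↔ (T φ ∧ T ψ))
  tEx : ∀ v φ, C.Var' v → C.Fml' φ → C.Sent' (C.ex' v φ) →
    (T (C.ex' v φ) ↔ ∃ x, T (C.subst φ v (C.num x)))
  tAll : ∀ v φ, C.Var' v → C.Fml' φ → C.Sent' (C.all' v φ) →
    (T (C.all' v φ) ↔ ∀ x, T (C.subst φ v (C.num x)))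
  tReg : ∀ φ s t, C.Fml' φ → C.ClTrmSeq' s → C.ClTrmSeq' t → C.valSeq s = C.valSeq t →
    (T (C.substSeq φ s) ↔ T (C.substSeq φ t))

/-- DC: a (possibly nonstandard) disjunction is true iff it has a true disjunct. -/
def DC (N : PAStruct) (C : Coding N) (T : N.M → Prop) : Prop :=
  ∀ s, C.SentSeq' s → (T (C.bigOr s) ↔ ∃ i, N.le i (C.lh s) ∧ T (C.app s i))

/-- DCout: a true disjunction has a true disjunct. -/
def DCout (N : PAStruct) (C : Coding N) (T : N.M → Prop) : Prop :=
  ∀ s, C.SentSeq' s → T (C.bigOr s) → ∃ i, N.le i (C.lh s) ∧ T (C.app s i)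

/-- DCin: a disjunction with a true disjunct is true. -/
def DCin (N : PAStruct) (C : Coding N) (T : N.M → Prop) : Prop :=
  ∀ s, C.SentSeq' s → (∃ i, N.le i (C.lh s) ∧ T (C.app s i)) → T (C.bigOr s)

/-- SeqInd: sequential induction for the predicate `T`. -/
def SeqInd (N : PAStruct) (C : Coding N) (T : N.M → Prop) : Prop :=
  ∀ s, C.FinSeq' s → T (C.app s N.zero) →
    (∀ i, N.lt (N.succ i) (C.lh s) → T (C.app s i) → T (C.app s (N.succ i))) →
    ∀ j, N.lt j (C.lh s) → T (C.app s j)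

/-- SeqOInd: sequential order induction for the predicate `T`. -/
def SeqOInd (N : PAStruct) (C : Coding N) (T : N.M → Prop) : Prop :=
  ∀ s, C.FinSeq' s →
    (∀ j, N.lt j (C.lh s) → (∀ i, N.lt i j → T (C.app s i)) → T (C.app s j)) →
    ∀ l, N.lt l (C.lh s) → T (C.app s l)

/-- INT: internal induction for the truth predicate. -/
def INT (N : PAStruct) (C : Coding N) (T : N.M → Prop) : Prop :=
  ∀ φ, C.Fml1' φ → T (C.subst1 φ N.zero) →
    (∀ x, T (C.subst1 φ x) → T (C.subst1 φ (N.succ x))) →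
    ∀ x, T (C.subst1 φ x)

/-- QFC: quantifier-free correctness. -/
def QFC (N : PAStruct) (C : Coding N) (T : N.M → Prop) : Prop :=
  ∀ φ, C.qfSent' φ → C.Tr0 φ → T φ

/-- PropSnd: every arithmetical sentence provable in pure propositional logic is true. -/
def PropSnd (N : PAStruct) (C : Coding N) (T : N.M → Prop) : Prop :=
  ∀ φ, C.Sent' φ → C.PrPropFrom ∅ φ → T φ

/-- PropRef: every arithmetical sentence derivable in propositional logic from true
    premises is true. -/
def PropRef (N : PAStruct) (C : Coding N) (T : N.M → Prop) : Prop :=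
  ∀ φ, C.Sent' φ → C.PrPropFrom {y | T y} φ → T φ

/-- CT₀ = CT⁻ + Δ₀-induction for the language with the truth predicate. -/
def CT0 (N : PAStruct) (C : Coding N) (T : N.M → Prop) : Prop :=
  CTminus N C T ∧ Delta0Ind N T

/-- A theory in the language of CT⁻, given semantically as a class of models. -/
def SemTheory := (N : PAStruct) → Coding N → (N.M → Prop) → Prop

/-- `(x, y)` is in the graph of the formula `D(x, y)` of L_PA ∪ {T} in `(N, T)`. -/
def Dgraph (N : PAStruct) (T : N.M → Prop) (D : TFml) (x y : N.M) : Prop :=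
  N.SatT T (fun n => if n = 0 then x else y) D

/-- The (provably functional) formula `D` is an outer disjunction in the model
    `(N, C, T)`. -/
def OuterDisjFml (N : PAStruct) (C : Coding N) (T : N.M → Prop) (D : TFml) : Prop :=
  (∀ x, ∃! y, Dgraph N T D x y) ∧
  (∀ s y, C.SentSeq' s → Dgraph N T D s y → C.Sent' y) ∧
  (∀ s ψ y y', C.SentSeq' s → C.Sent' ψ → Dgraph N T D (C.snoc s ψ) y → Dgraph N T D s y' →
    (T y ↔ (T y' ∨ T ψ))) ∧
  (∀ s y, C.SentSeq' s → Dgraph N T D s y → T y → ∃ i, N.le i (C.lh s) ∧ T (C.app s i))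

/-- The function `Df` on codes is an outer disjunction in `(N, C, T)`. -/
def OuterDisjFun (N : PAStruct) (C : Coding N) (T : N.M → Prop) (Df : N.M → N.M) : Prop :=
  (∀ s, C.SentSeq' s → C.Sent' (Df s)) ∧
  (∀ s ψ, C.SentSeq' s → C.Sent' ψ → (T (Df (C.snoc s ψ)) ↔ (T (Df s) ∨ T ψ))) ∧
  (∀ s, C.SentSeq' s → T (Df s) → ∃ i, N.le i (C.lh s) ∧ T (C.app s i))

/-- The theory `U` has outer disjunctions. -/
def HasOuterDisj (U : SemTheory) : Prop :=
  ∃ D : TFml, ∀ (N : PAStruct) (C : Coding N) (T : N.M → Prop),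
    U N C T → OuterDisjFml N C T D

/-- `ψ` is a direct subformula of `φ` (on codes). -/
def DirSub (N : PAStruct) (C : Coding N) (ψ φ : N.M) : Prop :=
  φ = C.not' ψ ∨
  (∃ η, φ = C.or' ψ η ∨ φ = C.or' η ψ ∨ φ = C.and' ψ η ∨ φ = C.and' η ψ) ∨
  (∃ v, φ = C.ex' v ψ ∨ φ = C.all' v ψ)

/-- Tarski's compositional clause `Comp(φ)` for the satisfaction relation `S`. -/
def CompClause (N : PAStruct) (C : Coding N) (S : N.M → N.M → Prop) (φ : N.M) : Prop :=
  (∃ s t, C.Trm' s ∧ C.Trm' t ∧ φ = C.eq' s t ∧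
    ∀ α, C.Asn φ α → (S φ α ↔ C.evalA s α = C.evalA t α)) ∨
  (∃ ψ, C.Fml' ψ ∧ φ = C.not' ψ ∧ ∀ α, C.Asn φ α → (S φ α ↔ ¬ S ψ α)) ∨
  (∃ ψ η, C.Fml' ψ ∧ C.Fml' η ∧ φ = C.or' ψ η ∧
    ∀ α, C.Asn φ α → (S φ α ↔ (S ψ α ∨ S η α))) ∨
  (∃ ψ η, C.Fml' ψ ∧ C.Fml' η ∧ φ = C.and' ψ η ∧
    ∀ α, C.Asn φ α → (S φ α ↔ (S ψ α ∧ S η α))) ∨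
  (∃ ψ v, C.Fml' ψ ∧ C.Var' v ∧ φ = C.ex' v ψ ∧
    ∀ α, C.Asn φ α → (S φ α ↔ ∃ β, C.asnExt β α v ∧ S ψ β)) ∨
  (∃ ψ v, C.Fml' ψ ∧ C.Var' v ∧ φ = C.all' v ψ ∧
    ∀ α, C.Asn φ α → (S φ α ↔ ∀ β, C.asnExt β α v → S ψ β))

/-- `S` is a satisfaction class with witnessing domain `D`. -/
def SatClassWith (N : PAStruct) (C : Coding N) (S : N.M → N.M → Prop) (D : Set N.M) : Prop :=
  (∀ φ ∈ D, C.Fml' φ) ∧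
  (∀ φ α, S φ α → C.Fml' φ ∧ C.Asn φ α) ∧
  (∀ φ α, S φ α → CompClause N C S φ) ∧
  (∀ φ α, S φ α → φ ∈ D ∨ ∃ ψ ∈ D, φ = C.not' ψ) ∧
  (∀ φ ∈ D, CompClause N C S φ) ∧
  (∀ φ ∈ D, ∀ ψ, C.Fml' ψ → DirSub N C ψ φ → ψ ∈ D) ∧
  (∀ φ ∈ D, ∀ α, C.Asn φ α → S φ α ∨ S (C.not' φ) α)

/-- `S` is a satisfaction class. -/
def IsSatClass (N : PAStruct) (C : Coding N) (S : N.M → N.M → Prop) : Prop :=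
  ∃ D, SatClassWith N C S D

/-- The domain of the satisfaction class `S` (the maximal witnessing set). -/
def satDom (N : PAStruct) (C : Coding N) (S : N.M → N.M → Prop) : Set N.M :=
  {φ | ∃ D, SatClassWith N C S D ∧ φ ∈ D}

/-- `S` is a full satisfaction class: its domain consists of all formulas. -/
def FullSatClass (N : PAStruct) (C : Coding N) (S : N.M → N.M → Prop) : Prop :=
  IsSatClass N C S ∧ ∀ φ, C.Fml' φ → φ ∈ satDom N C S

/-- Extensional equivalence of the pairs `(φ, α)` and `(ψ, β)`. -/
def ExtEquiv (N : PAStruct) (C : Coding N) (φ α ψ β : N.M) : Prop :=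
  ∃ η s t, C.Fml' η ∧ C.ClTrmSeq' s ∧ C.ClTrmSeq' t ∧ C.valSeq s = C.valSeq t ∧
    C.substA φ α = C.substSeq η s ∧ C.substA ψ β = C.substSeq η t

/-- `S` is invariant under extensional equivalence (regularity for satisfaction
    classes). -/
def RegularInv (N : PAStruct) (C : Coding N) (S : N.M → N.M → Prop) : Prop :=
  ∀ φ α ψ β, ExtEquiv N C φ α ψ β → (S φ α ↔ S ψ β)

/-- Internal induction holds for the satisfaction relation `S`. -/
def IntIndSat (N : PAStruct) (C : Coding N) (S : N.M → N.M → Prop) : Prop :=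
  ∀ φ, C.Fml1' φ → ∀ v, C.freeIn v φ → ∀ α, C.Asn φ α →
    S φ (C.asnUpd α N.zero v) →
    (∀ x, S φ (C.asnUpd α x v) → S φ (C.asnUpd α (N.succ x) v)) →
    ∀ x, S φ (C.asnUpd α x v)

/-- `j` is an elementary embedding of `N` into `N'`. -/
def ElemEmb (N N' : PAStruct) (j : N.M → N'.M) : Prop :=
  ∀ (φ : Fml) (v : ℕ → N.M), N.Sat v φ ↔ N'.Sat (fun n => j (v n)) φ

/-- The embedding `j` is compatible with the internal syntax of the two models
    (as is automatic for an elementary embedding and the definable coding). -/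
structure CodingEmb (N N' : PAStruct) (C : Coding N) (C' : Coding N') (j : N.M → N'.M) :
    Prop where
  fml : ∀ x, C.Fml' x ↔ C'.Fml' (j x)
  fml1 : ∀ x, C.Fml1' x ↔ C'.Fml1' (j x)
  sent : ∀ x, C.Sent' x ↔ C'.Sent' (j x)
  var : ∀ x, C.Var' x ↔ C'.Var' (j x)
  finSeq : ∀ x, C.FinSeq' x ↔ C'.FinSeq' (j x)
  fmlSeq : ∀ x, C.FmlSeq' x ↔ C'.FmlSeq' (j x)
  asn : ∀ x y, C.Asn x y ↔ C'.Asn (j x) (j y)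
  lh : ∀ x, j (C.lh x) = C'.lh (j x)
  app : ∀ x i, j (C.app x i) = C'.app (j x) (j i)
  not' : ∀ x, j (C.not' x) = C'.not' (j x)
  or' : ∀ x y, j (C.or' x y) = C'.or' (j x) (j y)
  and' : ∀ x y, j (C.and' x y) = C'.and' (j x) (j y)
  bigOr : ∀ x, j (C.bigOr x) = C'.bigOr (j x)
  substA : ∀ x y, j (C.substA x y) = C'.substA (j x) (j y)
  num : ∀ x, j (C.num x) = C'.num (j x)

/-- `bal` is the balanced disjunction operation on coded sequences of sentences. -/
def IsBalanced (N : PAStruct) (C : Coding N) (bal : N.M → N.M) : Prop :=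
  (∀ s, C.SentSeq' s → C.Sent' (bal s)) ∧
  (∀ s, C.SentSeq' s → C.lh s = N.zero →
    bal s = C.not' (C.eq' (C.num N.zero) (C.num N.zero))) ∧
  (∀ s, C.SentSeq' s → C.lh s = N.succ N.zero → bal s = C.app s N.zero) ∧
  (∀ s, C.SentSeq' s → N.le (N.succ (N.succ N.zero)) (C.lh s) →
    ∃ s₁ s₂ d, C.SentSeq' s₁ ∧ C.SentSeq' s₂ ∧ s = C.concat s₁ s₂ ∧ C.lh s₁ = d ∧
      (C.lh s = N.add d d ∨ C.lh s = N.succ (N.add d d)) ∧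
      bal s = C.or' (bal s₁) (bal s₂))


/-! ### Countability of the syntax -/

def Trm.code : Trm → ℕ
  | .var n => Nat.pair 0 n
  | .zero => Nat.pair 1 0
  | .succ t => Nat.pair 2 t.code
  | .add t u => Nat.pair 3 (Nat.pair t.code u.code)
  | .mul t u => Nat.pair 4 (Nat.pair t.code u.code)

theorem Trm.code_inj : Function.Injective Trm.code := by
  intro t
  induction t with
  | var n => intro u h; cases u <;> simp [Trm.code, Nat.pair_eq_pair] at h ⊢; exact h
  | zero => intro u h; cases u <;> simp [Trm.code, Nat.pair_eq_pair] at h ⊢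
  | succ t ih => intro u h; cases u <;> simp [Trm.code, Nat.pair_eq_pair] at h ⊢; exact ih h
  | add t u ih1 ih2 =>
    intro u h; cases u <;> simp [Trm.code, Nat.pair_eq_pair] at h ⊢; exact ⟨ih1 h.1, ih2 h.2⟩
  | mul t u ih1 ih2 =>
    intro u h; cases u <;> simp [Trm.code, Nat.pair_eq_pair] at h ⊢; exact ⟨ih1 h.1, ih2 h.2⟩

def Fml.code : Fml → ℕ
  | .eq t u => Nat.pair 0 (Nat.pair t.code u.code)
  | .not t => Nat.pair 1 t.code
  | .or t u => Nat.pair 2 (Nat.pair t.code u.code)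
  | .and t u => Nat.pair 3 (Nat.pair t.code u.code)
  | .ex n u => Nat.pair 4 (Nat.pair n u.code)
  | .all n u => Nat.pair 5 (Nat.pair n u.code)

theorem Fml.code_inj : Function.Injective Fml.code := by
  intro t
  induction t with
  | eq t u =>
    intro u h; cases u <;> simp [Fml.code, Nat.pair_eq_pair] at h ⊢
    exact ⟨Trm.code_inj h.1, Trm.code_inj h.2⟩
  | not t ih => intro u h; cases u <;> simp [Fml.code, Nat.pair_eq_pair] at h ⊢; exact ih h
  | or t u ih1 ih2 =>
    intro u h; cases u <;> simp [Fml.code, Nat.pair_eq_pair] at h ⊢; exact ⟨ih1 h.1, ih2 h.2⟩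
  | and t u ih1 ih2 =>
    intro u h; cases u <;> simp [Fml.code, Nat.pair_eq_pair] at h ⊢; exact ⟨ih1 h.1, ih2 h.2⟩
  | ex n u ih2 =>
    intro u h; cases u <;> simp [Fml.code, Nat.pair_eq_pair] at h ⊢; exact ⟨h.1, ih2 h.2⟩
  | all n u ih2 =>
    intro u h; cases u <;> simp [Fml.code, Nat.pair_eq_pair] at h ⊢; exact ⟨h.1, ih2 h.2⟩

def Fml0.code : Fml0 → ℕ
  | .eq t u => Nat.pair 0 (Nat.pair t.code u.code)
  | .not t => Nat.pair 1 t.code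
  | .or t u => Nat.pair 2 (Nat.pair t.code u.code)
  | .and t u => Nat.pair 3 (Nat.pair t.code u.code)
  | .bex n t u => Nat.pair 4 (Nat.pair n (Nat.pair t.code u.code))
  | .ball n t u => Nat.pair 5 (Nat.pair n (Nat.pair t.code u.code))

theorem Fml0.code_inj : Function.Injective Fml0.code := by
  intro t
  induction t with
  | eq t u =>
    intro u h; cases u <;> simp [Fml0.code, Nat.pair_eq_pair] at h ⊢
    exact ⟨Trm.code_inj h.1, Trm.code_inj h.2⟩
  | not t ih => intro u h; cases u <;> simp [Fml0.code, Nat.pair_eq_pair] at h ⊢; exact ih h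
  | or t u ih1 ih2 =>
    intro u h; cases u <;> simp [Fml0.code, Nat.pair_eq_pair] at h ⊢; exact ⟨ih1 h.1, ih2 h.2⟩
  | and t u ih1 ih2 =>
    intro u h; cases u <;> simp [Fml0.code, Nat.pair_eq_pair] at h ⊢; exact ⟨ih1 h.1, ih2 h.2⟩
  | bex n t u ih2 =>
    intro u h; cases u <;> simp [Fml0.code, Nat.pair_eq_pair] at h ⊢
    exact ⟨h.1, Trm.code_inj h.2.1, ih2 h.2.2⟩
  | ball n t u ih2 =>
    intro u h; cases u <;> simp [Fml0.code, Nat.pair_eq_pair] at h ⊢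
    exact ⟨h.1, Trm.code_inj h.2.1, ih2 h.2.2⟩

instance : Countable Fml := Fml.code_inj.countable
instance : Countable Fml0 := Fml0.code_inj.countable

/-! ### Support -/

def Trm.bd : Trm → ℕ
  | .var n => n + 1
  | .zero => 0
  | .succ t => t.bd
  | .add t u => max t.bd u.bd
  | .mul t u => max t.bd u.bd

def Fml.bd : Fml → ℕ
  | .eq t u => max t.bd u.bd
  | .not t => t.bd
  | .or t u => max t.bd u.bd
  | .and t u => max t.bd u.bd
  | .ex _ u => u.bd
  | .all _ u => u.bd

def Fml0.bd : Fml0 → ℕ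
  | .eq t u => max t.bd u.bd
  | .not t => t.bd
  | .or t u => max t.bd u.bd
  | .and t u => max t.bd u.bd
  | .bex _ t u => max t.bd u.bd
  | .ball _ t u => max t.bd u.bd

theorem evalT_congr (N : PAStruct) (v w : ℕ → N.M) (t : Trm) (h : ∀ i < t.bd, v i = w i) :
    N.evalT v t = N.evalT w t := by
  induction t with
  | var n => exact h n (by simp [Trm.bd])
  | zero => rfl
  | succ t ih => simp only [PAStruct.evalT]; rw [ih h]
  | add t u ih1 ih2 =>
    simp only [PAStruct.evalT, Trm.bd, lt_max_iff] at *
    rw [ih1 fun i hi => h i (Or.inl hi), ih2 fun i hi => h i (Or.inr hi)]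
  | mul t u ih1 ih2 =>
    simp only [PAStruct.evalT, Trm.bd, lt_max_iff] at *
    rw [ih1 fun i hi => h i (Or.inl hi), ih2 fun i hi => h i (Or.inr hi)]

theorem update_congr_lt {α : Type} {v w : ℕ → α} {B : ℕ} (h : ∀ i < B, v i = w i) (n : ℕ) (a : α) :
    ∀ i < B, Function.update v n a i = Function.update w n a i := by
  intro i hi
  by_cases hn : i = n
  · subst hn; simp
  · simp [hn, h i hi]

theorem Sat_congr (N : PAStruct) (φ : Fml) : ∀ (v w : ℕ → N.M), (∀ i < φ.bd, v i = w i) →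
    (N.Sat v φ ↔ N.Sat w φ) := by
  induction φ with
  | eq t u =>
    intro v w h
    simp only [PAStruct.Sat, Fml.bd, lt_max_iff] at *
    rw [evalT_congr N v w t fun i hi => h i (Or.inl hi),
      evalT_congr N v w u fun i hi => h i (Or.inr hi)]
  | not t ih => intro v w h; simp only [PAStruct.Sat]; rw [ih v w h]
  | or t u ih1 ih2 =>
    intro v w h
    simp only [PAStruct.Sat, Fml.bd, lt_max_iff] at *
    rw [ih1 v w fun i hi => h i (Or.inl hi), ih2 v w fun i hi => h i (Or.inr hi)]
  | and t u ih1 ih2 =>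
    intro v w h
    simp only [PAStruct.Sat, Fml.bd, lt_max_iff] at *
    rw [ih1 v w fun i hi => h i (Or.inl hi), ih2 v w fun i hi => h i (Or.inr hi)]
  | ex n u ih =>
    intro v w h
    simp only [PAStruct.Sat, Fml.bd] at *
    exact exists_congr fun a => ih _ _ (update_congr_lt h n a)
  | all n u ih =>
    intro v w h
    simp only [PAStruct.Sat, Fml.bd] at *
    exact forall_congr' fun a => ih _ _ (update_congr_lt h n a)

theorem Sat0_congr (N : PAStruct) (φ : Fml0) : ∀ (v w : ℕ → N.M), (∀ i < φ.bd, v i = w i) →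
    (N.Sat0 v φ ↔ N.Sat0 w φ) := by
  induction φ with
  | eq t u =>
    intro v w h
    simp only [PAStruct.Sat0, Fml0.bd, lt_max_iff] at *
    rw [evalT_congr N v w t fun i hi => h i (Or.inl hi),
      evalT_congr N v w u fun i hi => h i (Or.inr hi)]
  | not t ih => intro v w h; simp only [PAStruct.Sat0]; rw [ih v w h]
  | or t u ih1 ih2 =>
    intro v w h
    simp only [PAStruct.Sat0, Fml0.bd, lt_max_iff] at *
    rw [ih1 v w fun i hi => h i (Or.inl hi), ih2 v w fun i hi => h i (Or.inr hi)]
  | and t u ih1 ih2 =>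
    intro v w h
    simp only [PAStruct.Sat0, Fml0.bd, lt_max_iff] at *
    rw [ih1 v w fun i hi => h i (Or.inl hi), ih2 v w fun i hi => h i (Or.inr hi)]
  | bex n t u ih =>
    intro v w h
    simp only [PAStruct.Sat0, Fml0.bd, lt_max_iff] at *
    rw [evalT_congr N v w t fun i hi => h i (Or.inl hi)]
    exact exists_congr fun a => and_congr_right fun _ =>
      ih _ _ (update_congr_lt (fun i hi => h i (Or.inr hi)) n a)
  | ball n t u ih =>
    intro v w h
    simp only [PAStruct.Sat0, Fml0.bd, lt_max_iff] at *
    rw [evalT_congr N v w t fun i hi => h i (Or.inl hi)]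
    exact forall_congr' fun a => imp_congr_right fun _ =>
      ih _ _ (update_congr_lt (fun i hi => h i (Or.inr hi)) n a)

/-! ### The standard model and its sequence coding -/

@[reducible] def NS : PAStruct := ⟨ℕ, 0, Nat.succ, (· + ·), (· * ·)⟩

theorem NS_le (a b : ℕ) : NS.le a b ↔ a ≤ b :=
  ⟨fun ⟨c, hc⟩ => by have : a + c = b := hc; omega, fun h => ⟨b - a, by show a + (b - a) = b; omega⟩⟩

def slh (s : ℕ) : ℕ := s.unpair.1
def sapp (s i : ℕ) : ℕ := Nat.beta s.unpair.2 i
def smk (l : List ℕ) : ℕ := Nat.pair l.length (Nat.unbeta l)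

theorem slh_smk (l : List ℕ) : slh (smk l) = l.length := by simp [slh, smk]
theorem sapp_smk (l : List ℕ) (i : ℕ) (h : i < l.length) : sapp (smk l) i = l[i] := by
  simpa [sapp, smk] using Nat.beta_unbeta_coe l ⟨i, h⟩

def Psn (s x y : ℕ) : Prop :=
  slh y = slh s + 1 ∧ (∀ i < slh s, sapp y i = sapp s i) ∧ sapp y (slh s) = x

theorem Psn_ex (s x : ℕ) : ∃ y, Psn s x y := by
  refine ⟨smk ((List.range (slh s)).map (sapp s) ++ [x]), ?_, ?_, ?_⟩
  · simp [slh_smk]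
  · intro i hi
    rw [sapp_smk _ _ (by simp; omega)]
    rw [List.getElem_append_left (by simpa using hi)]
    simp
  · rw [sapp_smk _ _ (by simp)]
    simp

noncomputable def ssnoc (s x : ℕ) : ℕ := sInf {y | Psn s x y}

theorem ssnoc_spec (s x : ℕ) : Psn s x (ssnoc s x) := Nat.sInf_mem (Psn_ex s x)

theorem ssnoc_iff (s x y : ℕ) : ssnoc s x = y ↔ Psn s x y ∧ ∀ z ≤ y, z = y ∨ ¬ Psn s x z := by
  constructor
  · rintro rfl
    refine ⟨ssnoc_spec s x, fun z hz => ?_⟩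
    by_contra! h
    have : ssnoc s x ≤ z := Nat.sInf_le h.2
    exact h.1 (by omega)
  · rintro ⟨h1, h2⟩
    rcases h2 (ssnoc s x) (Nat.sInf_le h1) with h | h
    · exact h
    · exact absurd (ssnoc_spec s x) h

def sconcat (s t : ℕ) : ℕ :=
  smk ((List.range (slh s)).map (sapp s) ++ (List.range (slh t)).map (sapp t))

theorem sconcat_lh (s t : ℕ) : slh (sconcat s t) = slh s + slh t := by simp [sconcat, slh_smk]
theorem sconcat_l (s t i : ℕ) (h : i < slh s) : sapp (sconcat s t) i = sapp s i := by
  rw [sconcat, sapp_smk _ _ (by simp; omega), List.getElem_append_left (by simpa using h)]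
  simp
theorem sconcat_r (s t i : ℕ) (h : i < slh t) : sapp (sconcat s t) (slh s + i) = sapp t i := by
  rw [sconcat, sapp_smk _ _ (by simp; omega), List.getElem_append_right (by simp)]
  simp

def sid (d : ℕ) : ℕ := smk (List.range d)
theorem sid_lh (d : ℕ) : slh (sid d) = d := by simp [sid, slh_smk]
theorem sid_app (d i : ℕ) (h : i < d) : sapp (sid d) i = i := by
  rw [sid, sapp_smk _ _ (by simpa using h)]; simp

/-! ### Δ₀ definability in the standard model -/

def D0 (R : (ℕ → ℕ) → Prop) : Prop := ∃ φ : Fml0, ∀ v : ℕ → ℕ, NS.Sat0 v φ ↔ R v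

theorem D0.cg {R R' : (ℕ → ℕ) → Prop} (h : D0 R) (e : ∀ v, R v ↔ R' v) : D0 R' := by
  obtain ⟨φ, hφ⟩ := h
  exact ⟨φ, fun v => (hφ v).trans (e v)⟩

theorem D0.eq (t u : Trm) : D0 (fun v => NS.evalT v t = NS.evalT v u) :=
  ⟨.eq t u, fun _ => Iff.rfl⟩

theorem D0.not {R : (ℕ → ℕ) → Prop} : D0 R → D0 (fun v => ¬ R v) := fun ⟨φ, h⟩ =>
  ⟨.not φ, fun v => not_congr (h v)⟩

theorem D0.and {R S : (ℕ → ℕ) → Prop} : D0 R → D0 S → D0 (fun v => R v ∧ S v) :=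
  fun ⟨φ, h⟩ ⟨ψ, h'⟩ => ⟨.and φ ψ, fun v => and_congr (h v) (h' v)⟩

theorem D0.or {R S : (ℕ → ℕ) → Prop} : D0 R → D0 S → D0 (fun v => R v ∨ S v) :=
  fun ⟨φ, h⟩ ⟨ψ, h'⟩ => ⟨.or φ ψ, fun v => or_congr (h v) (h' v)⟩

theorem D0.bex {R : (ℕ → ℕ) → Prop} (n : ℕ) (t : Trm) : D0 R →
    D0 (fun v => ∃ a, a ≤ (NS.evalT v t : ℕ) ∧ R (Function.update v n a)) :=
  fun ⟨φ, h⟩ => ⟨.bex n t φ, fun v => exists_congr fun a => and_congr (NS_le _ _) (h _)⟩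

theorem D0.ball {R : (ℕ → ℕ) → Prop} (n : ℕ) (t : Trm) : D0 R →
    D0 (fun v => ∀ a, a ≤ (NS.evalT v t : ℕ) → R (Function.update v n a)) :=
  fun ⟨φ, h⟩ => ⟨.ball n t φ, fun v => forall_congr' fun a => imp_congr (NS_le _ _) (h _)⟩

theorem D0.le (t u : Trm) (ht : ∀ v (a : ℕ), NS.evalT (Function.update v 90 a) t = NS.evalT v t)
    (hu : ∀ v (a : ℕ), NS.evalT (Function.update v 90 a) u = NS.evalT v u) :
    D0 (fun v => (NS.evalT v t : ℕ) ≤ NS.evalT v u) := by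
  refine (D0.bex 90 u (D0.eq (.add t (.var 90)) u)).cg fun v => ?_
  simp only [PAStruct.evalT, ht, hu, Function.update_self]
  constructor
  · rintro ⟨a, _, h⟩; exact h ▸ Nat.le_add_right _ _
  · intro h; exact ⟨_, Nat.sub_le _ _, Nat.add_sub_cancel' h⟩

theorem D0.leV (a b : ℕ) (ha : a ≠ 90) (hb : b ≠ 90) : D0 (fun v => v a ≤ v b) := by
  refine (D0.le (.var a) (.var b) ?_ ?_).cg fun v => Iff.rfl
  · intro v x; simp [PAStruct.evalT, ha]
  · intro v x; simp [PAStruct.evalT, hb]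

theorem D0.pair (a b s : ℕ) (ha : a ≠ 90) (hb : b ≠ 90) :
    D0 (fun v => Nat.pair (v a) (v b) = v s) := by
  refine (((D0.leV b a hb ha).not.and (D0.eq (.add (.mul (.var b) (.var b)) (.var a)) (.var s))).or
    ((D0.leV b a hb ha).and
      (D0.eq (.add (.add (.mul (.var a) (.var a)) (.var a)) (.var b)) (.var s)))).cg fun v => ?_
  simp only [PAStruct.evalT, Nat.pair]
  split_ifs with h
  · have : ¬ v b ≤ v a := by omega
    simp [this]
  · have : v b ≤ v a := by omega
    simp [this]

theorem D0.lh (s l : ℕ) (hs : s < 90) (hl : l < 90) : D0 (fun v => slh (v s) = v l) := by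
  refine (D0.bex 91 (.var s) (D0.pair l 91 s (by omega) (by omega))).cg fun v => ?_
  have h1 : s ≠ 91 := by omega
  have h2 : l ≠ 91 := by omega
  simp only [PAStruct.evalT, Function.update_self, Function.update_of_ne h1,
    Function.update_of_ne h2, slh]
  constructor
  · rintro ⟨a, _, h⟩; rw [← h]; simp
  · intro h
    exact ⟨(v s).unpair.2, Nat.unpair_right_le _, by rw [← h, Nat.pair_unpair]⟩

theorem mod_iff (a m y : ℕ) : a % (m + 1) = y ↔ y ≤ m ∧ ∃ q ≤ a, a = q * (m + 1) + y := by
  constructor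
  · rintro rfl
    refine ⟨Nat.lt_succ_iff.1 (Nat.mod_lt _ (Nat.succ_pos _)), a / (m + 1), Nat.div_le_self _ _, ?_⟩
    rw [mul_comm]; exact (Nat.div_add_mod _ _).symm
  · rintro ⟨h, q, _, rfl⟩
    rw [add_comm, mul_comm, Nat.add_mul_mod_self_left]
    exact Nat.mod_eq_of_lt (by omega)

theorem sapp_iff (s i y : ℕ) : sapp s i = y ↔ ∃ l ≤ s, ∃ c ≤ s, Nat.pair l c = s ∧
    ∃ a ≤ s, ∃ b ≤ s, Nat.pair a b = c ∧ y ≤ (i + 1) * b ∧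
      ∃ q ≤ a, a = q * ((i + 1) * b + 1) + y := by
  constructor
  · intro h
    refine ⟨s.unpair.1, Nat.unpair_left_le _, s.unpair.2, Nat.unpair_right_le _, Nat.pair_unpair _,
      s.unpair.2.unpair.1, (Nat.unpair_left_le _).trans (Nat.unpair_right_le _),
      s.unpair.2.unpair.2, (Nat.unpair_right_le _).trans (Nat.unpair_right_le _),
      Nat.pair_unpair _, (mod_iff _ _ _).1 h⟩
  · rintro ⟨l, _, c, _, rfl, a, _, b, _, rfl, h⟩
    simpa [sapp, Nat.beta] using (mod_iff _ _ _).2 h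

theorem D0.app (s i y : ℕ) (hs : s < 90) (hi : i < 90) (hy : y < 90) :
    D0 (fun v => sapp (v s) (v i) = v y) := by
  have d1 : D0 (fun v => (NS.evalT v (.var y) : ℕ) ≤
      NS.evalT v (.mul (.succ (.var i)) (.var 95))) := by
    refine D0.le _ _ ?_ ?_
    · intro v a; simp [PAStruct.evalT, show y ≠ 90 by omega]
    · intro v a; simp [PAStruct.evalT, show i ≠ 90 by omega]
  refine (D0.bex 92 (.var s) (D0.bex 93 (.var s) ((D0.pair 92 93 s (by omega) (by omega)).and
    (D0.bex 94 (.var s) (D0.bex 95 (.var s) ((D0.pair 94 95 93 (by omega) (by omega)).and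
      (d1.and (D0.bex 96 (.var 94)
        (D0.eq (.var 94) (.add (.mul (.var 96) (.succ (.mul (.succ (.var i)) (.var 95))))
          (.var y))))))))))).cg fun v => ?_
  rw [sapp_iff]
  simp [PAStruct.evalT, Function.update, show s ≠ 92 by omega, show s ≠ 93 by omega,
    show s ≠ 94 by omega, show s ≠ 95 by omega, show s ≠ 96 by omega,
    show i ≠ 92 by omega, show i ≠ 93 by omega,
    show i ≠ 94 by omega, show i ≠ 95 by omega, show i ≠ 96 by omega,
    show y ≠ 92 by omega, show y ≠ 93 by omega,
    show y ≠ 94 by omega, show y ≠ 95 by omega, show y ≠ 96 by omega]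

theorem sapp_le (s i : ℕ) : sapp s i ≤ s :=
  (Nat.mod_le _ _).trans ((Nat.unpair_left_le _).trans (Nat.unpair_right_le _))

theorem slh_le (s : ℕ) : slh s ≤ s := Nat.unpair_left_le _

theorem Psn_iff (s x y : ℕ) : Psn s x y ↔ ∃ l ≤ s, slh s = l ∧ (∃ l' ≤ y, slh y = l' ∧ l' = l + 1) ∧
    (∀ i ≤ s, l ≤ i ∨ ∃ z ≤ y, sapp y i = z ∧ sapp s i = z) ∧ sapp y l = x := by
  constructor
  · rintro ⟨h1, h2, h3⟩
    refine ⟨_, slh_le s, rfl, ⟨_, slh_le y, rfl, h1⟩, fun i _ => ?_, h3⟩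
    rcases Nat.lt_or_ge i (slh s) with h | h
    · exact Or.inr ⟨_, sapp_le y i, rfl, (h2 i h).symm⟩
    · exact Or.inl h
  · rintro ⟨l, _, rfl, ⟨l', _, rfl, h1⟩, h2, h3⟩
    refine ⟨h1, fun i hi => ?_, h3⟩
    rcases h2 i (hi.le.trans (slh_le s)) with h | ⟨z, _, h, h'⟩
    · omega
    · rw [h, h']

theorem D0.Psn (s x y : ℕ) (hs : s < 80) (hx : x < 80) (hy : y < 80) :
    D0 (fun v => Psn (v s) (v x) (v y)) := by
  refine (D0.bex 80 (.var s) ((D0.lh s 80 (by omega) (by omega)).and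
    ((D0.bex 81 (.var y) ((D0.lh y 81 (by omega) (by omega)).and
      (D0.eq (.var 81) (.succ (.var 80))))).and
    ((D0.ball 82 (.var s) ((D0.leV 80 82 (by omega) (by omega)).or
      (D0.bex 83 (.var y) ((D0.app y 82 83 (by omega) (by omega) (by omega)).and
        (D0.app s 82 83 (by omega) (by omega) (by omega)))))).and
      (D0.app y 80 x (by omega) (by omega) (by omega)))))).cg fun v => ?_
  rw [Psn_iff]
  simp only [PAStruct.evalT, Function.update_apply, Nat.reduceEqDiff, ↓reduceIte, show s ≠ 80 by omega, show s ≠ 81 by omega,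
    show s ≠ 82 by omega, show s ≠ 83 by omega,
    show x ≠ 80 by omega, show x ≠ 81 by omega,
    show x ≠ 82 by omega, show x ≠ 83 by omega,
    show y ≠ 80 by omega, show y ≠ 81 by omega,
    show y ≠ 82 by omega, show y ≠ 83 by omega, Nat.succ_eq_add_one]

theorem D0.snoc : D0 (fun v => ssnoc (v 0) (v 1) = v 2) := by
  refine ((D0.Psn 0 1 2 (by omega) (by omega) (by omega)).and
    (D0.ball 3 (.var 2) ((D0.eq (.var 3) (.var 2)).or
      (D0.Psn 0 1 3 (by omega) (by omega) (by omega)).not))).cg fun v => ?_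
  rw [ssnoc_iff]
  simp [PAStruct.evalT, Function.update]

/-! ### A countable family of functions closed under Skolem functions -/

open Filter

def dec : ℕ → ℕ → ℕ
  | m, 0 => m.unpair.1
  | m, i + 1 => dec m.unpair.2 i

noncomputable def sk (R : (ℕ → ℕ) → Prop) (n m : ℕ) : ℕ :=
  sInf {a | R (Function.update (dec m) n a)}

def un2 (h : ℕ → ℕ → ℕ) : ℕ → ℕ := fun m => h m.unpair.1 m.unpair.2

def Bad (σ γ L j : ℕ) : Prop := γ < sapp σ j ∧ sapp σ j ∉ Denumerable.ofNat (List ℕ) L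

noncomputable def lb (m : ℕ) : ℕ :=
  sInf {j | Bad m.unpair.1 m.unpair.2.unpair.1 m.unpair.2.unpair.2 j}

def lcons (x L : ℕ) : ℕ := Encodable.encode (x :: Denumerable.ofNat (List ℕ) L)

def HB : Set (ℕ → ℕ) :=
  (Set.range fun p : Fml × ℕ => sk (fun v => NS.Sat v p.1) p.2) ∪
  (Set.range fun p : Fml0 × ℕ => sk (fun v => NS.Sat0 v p.1) p.2) ∪
  {fun _ => 0, Nat.succ, un2 (· + ·), un2 (· * ·), un2 (· - ·), slh, un2 sapp, un2 ssnoc,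
    un2 sconcat, sid, lb, un2 lcons}

theorem HB_countable : HB.Countable := by
  refine ((Set.countable_range _).union (Set.countable_range _)).union ?_
  exact Set.Finite.countable (by simp)

inductive FF : (ℕ → ℕ) → Prop
  | id : FF _root_.id
  | base (h f : ℕ → ℕ) : h ∈ HB → FF f → FF (h ∘ f)
  | pair (f g : ℕ → ℕ) : FF f → FF g → FF (fun k => Nat.pair (f k) (g k))

inductive Cd : Type
  | id : Cd
  | base : ℕ → Cd → Cd
  | pair : Cd → Cd → Cd

def Cd.code : Cd → ℕ
  | .id => Nat.pair 0 0
  | .base i c => Nat.pair 1 (Nat.pair i c.code)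
  | .pair c d => Nat.pair 2 (Nat.pair c.code d.code)

theorem Cd.code_inj : Function.Injective Cd.code := by
  intro t
  induction t with
  | id => intro u h; cases u <;> simp [Cd.code, Nat.pair_eq_pair] at h ⊢
  | base n t ih =>
    intro u h; cases u <;> simp [Cd.code, Nat.pair_eq_pair] at h ⊢; exact ⟨h.1, ih h.2⟩
  | pair t u ih1 ih2 =>
    intro u h; cases u <;> simp [Cd.code, Nat.pair_eq_pair] at h ⊢; exact ⟨ih1 h.1, ih2 h.2⟩

instance : Countable Cd := Cd.code_inj.countable

def Cd.ev (e : ℕ → ℕ → ℕ) : Cd → ℕ → ℕ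
  | .id => _root_.id
  | .base i c => e i ∘ c.ev e
  | .pair c d => fun k => Nat.pair (c.ev e k) (d.ev e k)

theorem FF_countable : {f | FF f}.Countable := by
  obtain ⟨e, he⟩ := HB_countable.exists_eq_range ⟨Nat.succ, by simp [HB]⟩
  refine (Set.countable_range (Cd.ev e)).mono ?_
  intro f hf
  induction hf with
  | id => exact ⟨.id, rfl⟩
  | base h f hh _ ih =>
    obtain ⟨c, rfl⟩ := ih
    rw [he] at hh
    obtain ⟨i, rfl⟩ := hh
    exact ⟨.base i c, rfl⟩
  | pair f g _ _ ih1 ih2 =>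
    obtain ⟨c, rfl⟩ := ih1
    obtain ⟨d, rfl⟩ := ih2
    exact ⟨.pair c d, rfl⟩

theorem FF.two {h : ℕ → ℕ → ℕ} (hh : un2 h ∈ HB) {f g : ℕ → ℕ} (hf : FF f) (hg : FF g) :
    FF (fun k => h (f k) (g k)) := by
  have := FF.base _ _ hh (FF.pair f g hf hg)
  convert this using 1
  ext k; simp [un2]

theorem FF_dec (B : ℕ) : ∀ f : ℕ → ℕ → ℕ, (∀ i, FF (f i)) →
    ∃ F, FF F ∧ ∀ k, ∀ i < B, dec (F k) i = f i k := by
  induction B with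
  | zero => intro f hf; exact ⟨f 0, hf 0, by simp⟩
  | succ B ih =>
    intro f hf
    obtain ⟨F, hF, h⟩ := ih (fun i => f (i + 1)) (fun i => hf _)
    refine ⟨_, FF.pair _ _ (hf 0) hF, fun k i hi => ?_⟩
    cases i with
    | zero => simp [dec]
    | succ i => simp [dec, h k i (by omega)]

/-- Least witnesses are given by functions of the family. -/
theorem FF_sk (R : (ℕ → ℕ) → Prop) (n B : ℕ) (hR : sk R n ∈ HB)
    (hB : ∀ v w : ℕ → ℕ, (∀ i < B, v i = w i) → (R v ↔ R w)) (f : ℕ → ℕ → ℕ)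
    (hf : ∀ i, FF (f i)) :
    ∃ g, FF g ∧ ∀ k a, R (Function.update (fun i => f i k) n a) →
      R (Function.update (fun i => f i k) n (g k)) ∧ g k ≤ a := by
  obtain ⟨F, hF, h⟩ := FF_dec B f hf
  refine ⟨_, FF.base _ _ hR hF, fun k a ha => ?_⟩
  have key : ∀ b, R (Function.update (dec (F k)) n b) ↔ R (Function.update (fun i => f i k) n b) :=
    fun b => hB _ _ (update_congr_lt (h k) n b)
  have ha' := (key a).2 ha
  exact ⟨(key _).1 (Nat.sInf_mem (s := {a | R (Function.update (dec (F k)) n a)}) ⟨a, ha'⟩),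
    Nat.sInf_le ha'⟩

theorem FF_sk1 (φ : Fml) (n : ℕ) (f : ℕ → ℕ → ℕ) (hf : ∀ i, FF (f i)) :
    ∃ g, FF g ∧ ∀ (k a : ℕ), NS.Sat (Function.update (fun i => f i k) n a) φ →
      NS.Sat (Function.update (fun i => f i k) n (g k)) φ ∧ g k ≤ a :=
  FF_sk (fun v => NS.Sat v φ) n φ.bd (Or.inl (Or.inl ⟨(φ, n), rfl⟩))
    (fun v w h => Sat_congr NS φ v w h) f hf

theorem FF_sk0 (φ : Fml0) (n : ℕ) (f : ℕ → ℕ → ℕ) (hf : ∀ i, FF (f i)) :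
    ∃ g, FF g ∧ ∀ (k a : ℕ), NS.Sat0 (Function.update (fun i => f i k) n a) φ →
      NS.Sat0 (Function.update (fun i => f i k) n (g k)) φ ∧ g k ≤ a :=
  FF_sk (fun v => NS.Sat0 v φ) n φ.bd (Or.inl (Or.inr ⟨(φ, n), rfl⟩))
    (fun v w h => Sat0_congr NS φ v w h) f hf

/-! ### The definable ultrapower -/

noncomputable abbrev UU : Ultrafilter ℕ := hyperfilter ℕ

abbrev GG : Type := Germ (UU : Filter ℕ) ℕ

abbrev MM : Type := {x : GG // ∃ f : ℕ → ℕ, FF f ∧ (f : GG) = x}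

noncomputable def mk (f : {f : ℕ → ℕ // FF f}) : MM := ⟨(f.1 : GG), f.1, f.2, rfl⟩

theorem mk_surj : Function.Surjective mk := by
  rintro ⟨_, f, hf, rfl⟩
  exact ⟨⟨f, hf⟩, rfl⟩

instance : Countable MM := by
  have : Countable {f : ℕ → ℕ // FF f} := FF_countable
  exact mk_surj.countable

theorem mk_eq {f g : {f : ℕ → ℕ // FF f}} : mk f = mk g ↔ ∀ᶠ k in UU, f.1 k = g.1 k := by
  rw [mk, mk, Subtype.mk.injEq, Germ.coe_eq]; rfl

theorem mk_le {f g : {f : ℕ → ℕ // FF f}} : mk f ≤ mk g ↔ ∀ᶠ k in UU, f.1 k ≤ g.1 k := by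
  rw [← Subtype.coe_le_coe, mk, mk, Germ.coe_le]; rfl

theorem mk_lt {f g : {f : ℕ → ℕ // FF f}} : mk f < mk g ↔ ∀ᶠ k in UU, f.1 k < g.1 k := by
  rw [← Subtype.coe_lt_coe, mk, mk, Germ.coe_lt]

noncomputable def lift1 (h : ℕ → ℕ) (hh : h ∈ HB) (x : MM) : MM :=
  ⟨Germ.map h x.1, by
    obtain ⟨_, f, hf, rfl⟩ := x
    exact ⟨_, FF.base h f hh hf, rfl⟩⟩

noncomputable def lift2 (h : ℕ → ℕ → ℕ) (hh : un2 h ∈ HB) (x y : MM) : MM :=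
  ⟨Germ.map₂ h x.1 y.1, by
    obtain ⟨_, f, hf, rfl⟩ := x
    obtain ⟨_, g, hg, rfl⟩ := y
    exact ⟨_, FF.two hh hf hg, rfl⟩⟩

theorem lift1_mk (h : ℕ → ℕ) (hh : h ∈ HB) (f : {f : ℕ → ℕ // FF f}) :
    lift1 h hh (mk f) = mk ⟨fun k => h (f.1 k), FF.base h f.1 hh f.2⟩ := rfl

theorem lift2_mk (h : ℕ → ℕ → ℕ) (hh : un2 h ∈ HB) (f g : {f : ℕ → ℕ // FF f}) :
    lift2 h hh (mk f) (mk g) = mk ⟨fun k => h (f.1 k) (g.1 k), FF.two hh f.2 g.2⟩ := rfl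

def zz : {f : ℕ → ℕ // FF f} := ⟨fun _ => 0, FF.base (fun _ => 0) _ (by simp [HB]) FF.id⟩

theorem hb_succ : Nat.succ ∈ HB := by simp [HB]
theorem hb_add : un2 (· + ·) ∈ HB := by simp [HB]
theorem hb_mul : un2 (· * ·) ∈ HB := by simp [HB]
theorem hb_sub : un2 (· - ·) ∈ HB := by simp [HB]
theorem hb_lh : slh ∈ HB := by simp [HB]
theorem hb_app : un2 sapp ∈ HB := by simp [HB]
theorem hb_snoc : un2 ssnoc ∈ HB := by simp [HB]
theorem hb_concat : un2 sconcat ∈ HB := by simp [HB]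
theorem hb_sid : sid ∈ HB := by simp [HB]
theorem hb_lb : lb ∈ HB := by simp [HB]
theorem hb_lcons : un2 lcons ∈ HB := by simp [HB]

@[reducible] noncomputable def NN : PAStruct :=
  ⟨MM, mk zz, lift1 Nat.succ hb_succ, lift2 (· + ·) hb_add, lift2 (· * ·) hb_mul⟩

theorem NN_le (a b : MM) : NN.le a b ↔ a ≤ b := by
  obtain ⟨f, rfl⟩ := mk_surj a
  obtain ⟨g, rfl⟩ := mk_surj b
  rw [mk_le]
  constructor
  · rintro ⟨c, hc⟩
    obtain ⟨c, rfl⟩ := mk_surj c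
    have hc : lift2 (· + ·) hb_add (mk f) (mk c) = mk g := hc
    rw [lift2_mk, mk_eq] at hc
    filter_upwards [hc] with k hk
    omega
  · intro h
    refine ⟨lift2 (· - ·) hb_sub (mk g) (mk f), ?_⟩
    show lift2 (· + ·) hb_add (mk f) _ = mk g
    rw [lift2_mk, lift2_mk, mk_eq]
    filter_upwards [h] with k hk
    show f.1 k + (g.1 k - f.1 k) = g.1 k
    omega

theorem NN_lt (a b : MM) : NN.lt a b ↔ a < b := by
  unfold PAStruct.lt
  rw [NN_le]
  obtain ⟨f, rfl⟩ := mk_surj a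
  obtain ⟨g, rfl⟩ := mk_surj b
  show lift1 Nat.succ hb_succ (mk f) ≤ _ ↔ _
  rw [lift1_mk, mk_le, mk_lt]
  rfl

theorem update_mk (F : ℕ → {f : ℕ → ℕ // FF f}) (n : ℕ) (g : {f : ℕ → ℕ // FF f}) :
    Function.update (fun i => mk (F i)) n (mk g) = fun i => mk (Function.update F n g i) := by
  ext i
  by_cases h : i = n
  · subst h; simp
  · simp [h]

theorem update_ev (F : ℕ → {f : ℕ → ℕ // FF f}) (n : ℕ) (g : {f : ℕ → ℕ // FF f}) (k : ℕ) :
    (fun i => (Function.update F n g i).1 k) = Function.update (fun i => (F i).1 k) n (g.1 k) := by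
  ext i
  by_cases h : i = n
  · subst h; simp
  · simp [h]

theorem evalT_mk (F : ℕ → {f : ℕ → ℕ // FF f}) (t : Trm) :
    ∃ h : FF (fun k => NS.evalT (fun i => (F i).1 k) t), NN.evalT (fun i => mk (F i)) t = mk ⟨_, h⟩ := by
  induction t with
  | var n => exact ⟨(F n).2, rfl⟩
  | zero => exact ⟨zz.2, rfl⟩
  | succ t ih =>
    obtain ⟨h, e⟩ := ih
    exact ⟨FF.base _ _ hb_succ h, congrArg (lift1 Nat.succ hb_succ) e⟩
  | add t u ih1 ih2 =>
    obtain ⟨h, e⟩ := ih1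
    obtain ⟨h', e'⟩ := ih2
    exact ⟨FF.two hb_add h h', congrArg₂ (lift2 (· + ·) hb_add) e e'⟩
  | mul t u ih1 ih2 =>
    obtain ⟨h, e⟩ := ih1
    obtain ⟨h', e'⟩ := ih2
    exact ⟨FF.two hb_mul h h', congrArg₂ (lift2 (· * ·) hb_mul) e e'⟩

theorem evalT_eq (F : ℕ → {f : ℕ → ℕ // FF f}) (t u : Trm) :
    NN.evalT (fun i => mk (F i)) t = NN.evalT (fun i => mk (F i)) u ↔
    ∀ᶠ k in UU, NS.evalT (fun i => (F i).1 k) t = NS.evalT (fun i => (F i).1 k) u := by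
  obtain ⟨h, e⟩ := evalT_mk F t
  obtain ⟨h', e'⟩ := evalT_mk F u
  rw [e, e', mk_eq]

theorem los (φ : Fml) : ∀ F : ℕ → {f : ℕ → ℕ // FF f},
    NN.Sat (fun i => mk (F i)) φ ↔ ∀ᶠ k in UU, NS.Sat (fun i => (F i).1 k) φ := by
  induction φ with
  | eq t u => exact fun F => evalT_eq F t u
  | not φ ih =>
    intro F
    simp only [PAStruct.Sat]
    rw [ih, Ultrafilter.eventually_not]
  | or φ ψ ih1 ih2 =>
    intro F
    simp only [PAStruct.Sat]
    rw [ih1, ih2, Ultrafilter.eventually_or]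
  | and φ ψ ih1 ih2 =>
    intro F
    simp only [PAStruct.Sat]
    rw [ih1, ih2, eventually_and]
  | ex n φ ih =>
    intro F
    simp only [PAStruct.Sat]
    constructor
    · rintro ⟨a, ha⟩
      obtain ⟨g, rfl⟩ := mk_surj a
      rw [update_mk, ih] at ha
      filter_upwards [ha] with k hk
      rw [update_ev] at hk
      exact ⟨_, hk⟩
    · intro h
      obtain ⟨g, hg, hs⟩ := FF_sk1 φ n (fun i => (F i).1) (fun i => (F i).2)
      refine ⟨mk ⟨g, hg⟩, ?_⟩
      rw [update_mk, ih]
      filter_upwards [h] with k ⟨a, ha⟩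
      rw [update_ev]
      exact (hs k a ha).1
  | all n φ ih =>
    intro F
    simp only [PAStruct.Sat]
    constructor
    · intro h
      obtain ⟨g, hg, hs⟩ := FF_sk1 (.not φ) n (fun i => (F i).1) (fun i => (F i).2)
      have := h (mk ⟨g, hg⟩)
      rw [update_mk, ih] at this
      filter_upwards [this] with k hk a
      rw [update_ev] at hk
      by_contra ha
      exact (hs k a ha).1 hk
    · intro h a
      obtain ⟨g, rfl⟩ := mk_surj a
      rw [update_mk, ih]
      filter_upwards [h] with k hk
      rw [update_ev]
      exact hk _

theorem los0 (φ : Fml0) : ∀ F : ℕ → {f : ℕ → ℕ // FF f},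
    NN.Sat0 (fun i => mk (F i)) φ ↔ ∀ᶠ k in UU, NS.Sat0 (fun i => (F i).1 k) φ := by
  induction φ with
  | eq t u => exact fun F => evalT_eq F t u
  | not φ ih =>
    intro F
    simp only [PAStruct.Sat0]
    rw [ih, Ultrafilter.eventually_not]
  | or φ ψ ih1 ih2 =>
    intro F
    simp only [PAStruct.Sat0]
    rw [ih1, ih2, Ultrafilter.eventually_or]
  | and φ ψ ih1 ih2 =>
    intro F
    simp only [PAStruct.Sat0]
    rw [ih1, ih2, eventually_and]
  | bex n t φ ih =>
    intro F
    obtain ⟨ht, et⟩ := evalT_mk F t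
    simp only [PAStruct.Sat0, et, NN_le, NS_le]
    constructor
    · rintro ⟨a, hl, ha⟩
      obtain ⟨g, rfl⟩ := mk_surj a
      rw [update_mk, ih] at ha
      rw [mk_le] at hl
      filter_upwards [ha, hl] with k hk hl
      rw [update_ev] at hk
      exact ⟨_, hl, hk⟩
    · intro h
      obtain ⟨g, hg, hs⟩ := FF_sk0 φ n (fun i => (F i).1) (fun i => (F i).2)
      refine ⟨mk ⟨g, hg⟩, ?_, ?_⟩
      · rw [mk_le]
        filter_upwards [h] with k ⟨a, hl, ha⟩
        exact (hs k a ha).2.trans hl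
      rw [update_mk, ih]
      filter_upwards [h] with k ⟨a, hl, ha⟩
      rw [update_ev]
      exact (hs k a ha).1
  | ball n t φ ih =>
    intro F
    obtain ⟨ht, et⟩ := evalT_mk F t
    simp only [PAStruct.Sat0, et, NN_le, NS_le]
    constructor
    · intro h
      by_contra hc
      rw [← Ultrafilter.eventually_not] at hc
      obtain ⟨g, hg, hs⟩ := FF_sk0 (.not φ) n (fun i => (F i).1) (fun i => (F i).2)
      have := h (mk ⟨g, hg⟩) (by
        rw [mk_le]
        filter_upwards [hc] with k hk
        push Not at hk
        obtain ⟨a, hl, ha⟩ := hk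
        exact (hs k a ha).2.trans hl)
      rw [update_mk, ih] at this
      obtain ⟨k, hk, hk'⟩ := (hc.and this).exists
      push Not at hk
      obtain ⟨a, hl, ha⟩ := hk
      rw [update_ev] at hk'
      exact (hs k a ha).1 hk'
    · intro h a hl
      obtain ⟨g, rfl⟩ := mk_surj a
      rw [mk_le] at hl
      rw [update_mk, ih]
      filter_upwards [h, hl] with k hk hl
      rw [update_ev]
      exact hk _ hl

theorem NN_PA : NN.ModelOfPA := by
  refine ⟨?_, ?_, ?_, ?_, ?_, ?_, ?_⟩
  · intro x h
    obtain ⟨f, rfl⟩ := mk_surj x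
    have h : lift1 Nat.succ hb_succ (mk f) = mk zz := h
    rw [lift1_mk, mk_eq] at h
    obtain ⟨k, hk⟩ := h.exists
    exact Nat.succ_ne_zero _ hk
  · intro x y h
    obtain ⟨f, rfl⟩ := mk_surj x
    obtain ⟨g, rfl⟩ := mk_surj y
    have h : lift1 Nat.succ hb_succ (mk f) = lift1 Nat.succ hb_succ (mk g) := h
    rw [lift1_mk, lift1_mk, mk_eq] at h
    rw [mk_eq]
    filter_upwards [h] with k hk
    exact Nat.succ.inj hk
  · intro x
    obtain ⟨f, rfl⟩ := mk_surj x
    rfl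
  · intro x y
    obtain ⟨f, rfl⟩ := mk_surj x
    obtain ⟨g, rfl⟩ := mk_surj y
    rfl
  · intro x
    obtain ⟨f, rfl⟩ := mk_surj x
    rfl
  · intro x y
    obtain ⟨f, rfl⟩ := mk_surj x
    obtain ⟨g, rfl⟩ := mk_surj y
    rfl
  · intro φ n v h0 hs a
    obtain ⟨F, rfl⟩ : ∃ F : ℕ → {f : ℕ → ℕ // FF f}, (fun i => mk (F i)) = v :=
      ⟨fun i => (mk_surj (v i)).choose, funext fun i => (mk_surj (v i)).choose_spec⟩
    obtain ⟨x, rfl⟩ := mk_surj a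
    obtain ⟨g, hg, hl⟩ := FF_sk1 (.not φ) n (fun i => (F i).1) (fun i => (F i).2)
    have key : ∀ y : {f : ℕ → ℕ // FF f}, NN.Sat (Function.update (fun i => mk (F i)) n (mk y)) φ ↔
        ∀ᶠ k in UU, NS.Sat (Function.update (fun i => (F i).1 k) n (y.1 k)) φ := by
      intro y
      rw [update_mk, los]
      simp only [update_ev]
    by_contra hc
    rw [key, ← Ultrafilter.eventually_not] at hc
    have h1 : ∀ᶠ k in UU, ¬ NS.Sat (Function.update (fun i => (F i).1 k) n (g k)) φ := by
      filter_upwards [hc] with k hk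
      exact (hl k _ hk).1
    have h0 := (key zz).1 h0
    have h2 : ∀ᶠ k in UU, NS.Sat (Function.update (fun i => (F i).1 k) n (g k - 1)) φ := by
      filter_upwards [h0, h1] with k hk0 hk1
      by_contra h
      have := (hl k _ h).2
      have h0 : g k = 0 := by omega
      rw [h0] at hk1
      exact hk1 hk0
    have hone : FF (fun _ => 1) := FF.base _ _ hb_succ zz.2
    have h3 := (key ⟨_, FF.two hb_sub hg hone⟩).2 h2
    have h4 := (key ⟨_, FF.base _ _ hb_succ (FF.two hb_sub hg hone)⟩).1 (hs _ h3)
    obtain ⟨k, hk0, hk1, hk4⟩ := (h0.and (h1.and h4)).exists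
    have hk4 : NS.Sat (Function.update (fun i => (F i).1 k) n (g k - 1 + 1)) φ := hk4
    by_cases h : g k = 0
    · rw [h] at hk1; exact hk1 hk0
    · rw [Nat.sub_add_cancel (by omega)] at hk4
      exact hk1 hk4

/-! ### The coding -/

theorem def2 (h : ℕ → ℕ) (hh : h ∈ HB) (d : D0 (fun v => h (v 0) = v 1)) :
    Definable2 NN (fun x y => lift1 h hh x = y) := by
  obtain ⟨φ, hφ⟩ := d
  refine ⟨φ, fun x y => ?_⟩
  obtain ⟨f, rfl⟩ := mk_surj x
  obtain ⟨g, rfl⟩ := mk_surj y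
  have e : (fun n : ℕ => if n = 0 then mk f else mk g) =
      fun n => mk (if n = 0 then f else g) := by
    ext n; split_ifs <;> rfl
  show lift1 h hh (mk f) = mk g ↔ NN.Sat0 (fun n : ℕ => if n = 0 then mk f else mk g) φ
  rw [e, los0]
  rw [lift1_mk, mk_eq]
  refine eventually_congr (Eventually.of_forall fun k => ?_)
  rw [hφ]
  simp

theorem def3 (h : ℕ → ℕ → ℕ) (hh : un2 h ∈ HB) (d : D0 (fun v => h (v 0) (v 1) = v 2)) :
    Definable3 NN (fun x y z => lift2 h hh x y = z) := by
  obtain ⟨φ, hφ⟩ := d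
  refine ⟨φ, fun x y z => ?_⟩
  obtain ⟨f, rfl⟩ := mk_surj x
  obtain ⟨g, rfl⟩ := mk_surj y
  obtain ⟨p, rfl⟩ := mk_surj z
  have e : (fun n : ℕ => if n = 0 then mk f else if n = 1 then mk g else mk p) =
      fun n => mk (if n = 0 then f else if n = 1 then g else p) := by
    ext n; split_ifs <;> rfl
  show lift2 h hh (mk f) (mk g) = mk p ↔
    NN.Sat0 (fun n : ℕ => if n = 0 then mk f else if n = 1 then mk g else mk p) φ
  rw [e, los0]
  rw [lift2_mk, mk_eq]
  refine eventually_congr (Eventually.of_forall fun k => ?_)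
  rw [hφ]
  simp

noncomputable def clh : MM → MM := lift1 slh hb_lh
noncomputable def capp : MM → MM → MM := lift2 sapp hb_app
noncomputable def csnoc : MM → MM → MM := lift2 ssnoc hb_snoc
noncomputable def cconcat : MM → MM → MM := lift2 sconcat hb_concat
noncomputable def csucc : MM → MM := lift1 Nat.succ hb_succ
noncomputable def cz : MM := mk zz

theorem csnoc_lh (s x : MM) : clh (csnoc s x) = csucc (clh s) := by
  obtain ⟨f, rfl⟩ := mk_surj s
  obtain ⟨g, rfl⟩ := mk_surj x
  rw [clh, csnoc, csucc, lift2_mk, lift1_mk, lift1_mk, lift1_mk, mk_eq]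
  exact Eventually.of_forall fun k => (ssnoc_spec _ _).1

theorem csnoc_app (s x i : MM) (hi : i < clh s) : capp (csnoc s x) i = capp s i := by
  obtain ⟨f, rfl⟩ := mk_surj s
  obtain ⟨g, rfl⟩ := mk_surj x
  obtain ⟨p, rfl⟩ := mk_surj i
  rw [clh, lift1_mk, mk_lt] at hi
  rw [capp, csnoc, lift2_mk, lift2_mk, lift2_mk, mk_eq]
  filter_upwards [hi] with k hk
  exact (ssnoc_spec _ _).2.1 _ hk

theorem csnoc_last (s x : MM) : capp (csnoc s x) (clh s) = x := by
  obtain ⟨f, rfl⟩ := mk_surj s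
  obtain ⟨g, rfl⟩ := mk_surj x
  rw [capp, csnoc, clh, lift2_mk, lift1_mk, lift2_mk, mk_eq]
  exact Eventually.of_forall fun k => (ssnoc_spec _ _).2.2

noncomputable def cadd : MM → MM → MM := lift2 (· + ·) hb_add

theorem cconcat_lh (s x : MM) : clh (cconcat s x) = cadd (clh s) (clh x) := by
  obtain ⟨f, rfl⟩ := mk_surj s
  obtain ⟨g, rfl⟩ := mk_surj x
  rw [clh, cconcat, cadd, lift2_mk, lift1_mk, lift1_mk, lift1_mk, lift2_mk, mk_eq]
  refine Eventually.of_forall fun k => ?_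
  dsimp only
  rw [sconcat_lh]

theorem cconcat_l (s x i : MM) (hi : i < clh s) : capp (cconcat s x) i = capp s i := by
  obtain ⟨f, rfl⟩ := mk_surj s
  obtain ⟨g, rfl⟩ := mk_surj x
  obtain ⟨p, rfl⟩ := mk_surj i
  rw [clh, lift1_mk, mk_lt] at hi
  rw [capp, cconcat, lift2_mk, lift2_mk, lift2_mk, mk_eq]
  filter_upwards [hi] with k hk
  exact sconcat_l (f.1 k) (g.1 k) (p.1 k) hk

theorem cconcat_r (s x i : MM) (hi : i < clh x) :
    capp (cconcat s x) (cadd (clh s) i) = capp x i := by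
  obtain ⟨f, rfl⟩ := mk_surj s
  obtain ⟨g, rfl⟩ := mk_surj x
  obtain ⟨p, rfl⟩ := mk_surj i
  rw [clh, lift1_mk, mk_lt] at hi
  rw [capp, cconcat, cadd, clh, lift2_mk, lift1_mk, lift2_mk, lift2_mk, lift2_mk, mk_eq]
  filter_upwards [hi] with k hk
  exact sconcat_r (f.1 k) (g.1 k) (p.1 k) hk

noncomputable def CC : Coding NN where
  Var' := fun _ => True
  Trm' := fun _ => True
  ClTrm' := fun _ => True
  Fml' := fun _ => True
  Fml1' := fun _ => True
  Sent' := fun x => x = cz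
  qfSent' := fun x => x = cz
  FinSeq' := fun _ => True
  SentSeq' := fun s => True ∧ ∀ i, NN.lt i (clh s) → capp s i = cz
  FmlSeq' := fun _ => True
  ClTrmSeq' := fun _ => True
  lh := clh
  app := capp
  snoc := csnoc
  concat := cconcat
  negSeq := id
  val := id
  valSeq := id
  num := id
  eq' := fun _ _ => cz
  not' := id
  or' := fun _ _ => cz
  and' := fun _ _ => cz
  ex' := fun _ _ => cz
  all' := fun _ _ => cz
  bigOr := fun _ => cz
  subst := fun _ _ _ => cz
  substSeq := fun _ _ => cz
  subst1 := fun _ _ => cz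
  Asn := fun _ _ => True
  substA := fun _ _ => cz
  evalA := fun _ _ => cz
  asnUpd := fun _ _ _ => cz
  asnExt := fun _ _ _ => True
  emptyAsn := cz
  freeIn := fun _ _ => True
  Tr0 := fun _ => True
  PrPropFrom := fun _ _ => True
  sent_fml := fun _ _ => trivial
  fml1_fml := fun _ _ => trivial
  qf_sent := fun _ h => h
  clt_trm := fun _ _ => trivial
  num_cl := fun _ => trivial
  val_num := fun _ => rfl
  sentSeq_iff := fun _ => Iff.rfl
  fmlSeq_iff := fun _ => by simp
  snoc_fin := fun _ _ _ => trivial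
  snoc_lh := fun s x _ => csnoc_lh s x
  snoc_app := fun s x i _ hi => csnoc_app s x i ((NN_lt _ _).1 hi)
  snoc_last := fun s x _ => csnoc_last s x
  concat_fin := fun _ _ _ _ => trivial
  concat_lh := fun s x _ _ => cconcat_lh s x
  concat_app_l := fun s x i _ _ hi => cconcat_l s x i ((NN_lt _ _).1 hi)
  concat_app_r := fun s x i _ _ hi => cconcat_r s x i ((NN_lt _ _).1 hi)
  negSeq_seq := fun _ h => h
  negSeq_lh := fun _ _ => rfl
  negSeq_app := fun _ _ _ _ => rfl
  sent_not := fun _ h => h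
  sent_or := fun _ _ _ _ => rfl
  sent_and := fun _ _ _ _ => rfl
  sent_eq := fun _ _ _ _ => rfl
  bigOr_sent := fun _ _ => rfl
  bigOr_one := by
    intro s hs h1
    refine (hs.2 _ ?_).symm
    rw [h1]
    exact ⟨NN.zero, NN_PA.2.2.1 _⟩
  bigOr_snoc := fun _ _ _ _ _ => rfl
  substA_sent := fun _ _ _ _ => rfl
  emptyAsn_asn := fun _ _ => trivial
  asnUpd_asn := fun _ _ _ _ _ => trivial
  df_sent := ⟨.eq (.var 0) .zero, fun _ => Iff.rfl⟩
  df_fin := ⟨.eq .zero .zero, fun _ => ⟨fun _ => rfl, fun _ => trivial⟩⟩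
  df_lh := def2 slh hb_lh (D0.lh 0 1 (by omega) (by omega))
  df_app := def3 sapp hb_app (D0.app 0 1 2 (by omega) (by omega) (by omega))
  df_bigOr := ⟨.eq .zero (.var 1), fun _ _ => Iff.rfl⟩
  df_not := ⟨.eq (.var 0) (.var 1), fun _ _ => Iff.rfl⟩
  df_or := ⟨.eq .zero (.var 2), fun _ _ _ => Iff.rfl⟩
  df_num := ⟨.eq (.var 0) (.var 1), fun _ _ => Iff.rfl⟩
  df_negSeq := ⟨.eq (.var 0) (.var 1), fun _ _ => Iff.rfl⟩
  df_snoc := def3 ssnoc hb_snoc D0.snoc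

/-! ### Standard and nonstandard elements -/

def Std (x : MM) : Prop := ∃ n : ℕ, x = NN.std n

theorem std_mk (n : ℕ) : ∃ h : FF (fun _ => n), NN.std n = mk ⟨fun _ => n, h⟩ := by
  induction n with
  | zero => exact ⟨zz.2, rfl⟩
  | succ n ih =>
    obtain ⟨h, e⟩ := ih
    have h' : FF (fun _ => n + 1) := FF.base Nat.succ (fun _ => n) hb_succ h
    exact ⟨h', congrArg (lift1 Nat.succ hb_succ) e⟩

theorem std_of_le (n : ℕ) : ∀ x : MM, x ≤ NN.std n → Std x := by
  induction n with
  | zero =>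
    intro x h
    obtain ⟨f, rfl⟩ := mk_surj x
    refine ⟨0, ?_⟩
    have h : mk f ≤ mk zz := h
    show mk f = mk zz
    rw [mk_le] at h
    rw [mk_eq]
    filter_upwards [h] with k hk
    exact Nat.le_zero.1 hk
  | succ n ih =>
    intro x h
    by_cases hx : x = NN.std (n + 1)
    · exact ⟨_, hx⟩
    · have hlt : x < NN.std (n + 1) := lt_of_le_of_ne h hx
      apply ih
      obtain ⟨f, rfl⟩ := mk_surj x
      obtain ⟨h1, e1⟩ := std_mk n
      obtain ⟨h2, e2⟩ := std_mk (n + 1)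
      rw [e2, mk_lt] at hlt
      rw [e1, mk_le]
      filter_upwards [hlt] with k hk
      exact Nat.lt_succ_iff.1 hk

theorem std_le_of_not {x y : MM} (hx : Std x) (hy : ¬ Std y) : x < y := by
  obtain ⟨n, rfl⟩ := hx
  by_contra h
  exact hy (std_of_le n y (not_lt.1 h))

theorem std_down {x y : MM} (hy : Std y) (h : x ≤ y) : Std x := by
  obtain ⟨n, rfl⟩ := hy
  exact std_of_le n x h

theorem nonstd_pred {x : MM} (hx : ¬ Std x) : ∃ y, ¬ Std y ∧ y < x := by
  obtain ⟨f, rfl⟩ := mk_surj x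
  have hone : FF (fun _ => 1) := FF.base _ _ hb_succ zz.2
  have h0 : mk zz < mk f := std_le_of_not ⟨0, rfl⟩ hx
  rw [mk_lt] at h0
  refine ⟨mk ⟨_, FF.two hb_sub f.2 hone⟩, ?_, ?_⟩
  · rintro ⟨n, hn⟩
    apply hx
    refine ⟨n + 1, ?_⟩
    show _ = csucc (NN.std n)
    rw [← hn, csucc, lift1_mk, mk_eq]
    filter_upwards [h0] with k hk
    have hk : 0 < f.1 k := hk
    show f.1 k = f.1 k - 1 + 1
    omega
  · rw [mk_lt]
    filter_upwards [h0] with k hk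
    have hk : 0 < f.1 k := hk
    show f.1 k - 1 < f.1 k
    omega

theorem exists_nonstd : ∃ x : MM, ¬ Std x := by
  refine ⟨mk ⟨_, FF.id⟩, ?_⟩
  rintro ⟨n, hn⟩
  obtain ⟨h, e⟩ := std_mk n
  rw [e, mk_eq] at hn
  have : ({n}ᶜ : Set ℕ) ∈ (hyperfilter ℕ : Filter ℕ) :=
    (Set.finite_singleton n).compl_mem_hyperfilter
  obtain ⟨k, hk, hk'⟩ := (hn.and (show ∀ᶠ k in (UU : Filter ℕ), k ∈ ({n}ᶜ : Set ℕ) from this)).exists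
  exact hk' hk

/-! ### Internal induction for finite modifications of initial segments -/

theorem list_code (A : List MM) : ∃ L : {f : ℕ → ℕ // FF f}, ∀ x : {f : ℕ → ℕ // FF f},
    mk x ∈ A ↔ ∀ᶠ k in UU, x.1 k ∈ Denumerable.ofNat (List ℕ) (L.1 k) := by
  induction A with
  | nil => exact ⟨zz, fun x => by
      simp [zz, Denumerable.list_ofNat_zero]
      exact UU.neBot.ne⟩
  | cons a A ih =>
    obtain ⟨L, hL⟩ := ih
    obtain ⟨a, rfl⟩ := mk_surj a
    refine ⟨⟨_, FF.two hb_lcons a.2 L.2⟩, fun x => ?_⟩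
    rw [List.mem_cons, mk_eq, hL, ← Ultrafilter.eventually_or]
    simp [lcons]

theorem key_step (s c : MM) (A : List MM) (j : MM) (h0 : capp s cz ≤ c ∨ capp s cz ∈ A)
    (hj : c < capp s j) (hjA : capp s j ∉ A) :
    ∃ i, csucc i ≤ j ∧ (capp s i ≤ c ∨ capp s i ∈ A) ∧ c < capp s (csucc i) ∧
      capp s (csucc i) ∉ A := by
  obtain ⟨L, hL⟩ := list_code A
  obtain ⟨s, rfl⟩ := mk_surj s
  obtain ⟨c, rfl⟩ := mk_surj c
  obtain ⟨j, rfl⟩ := mk_surj j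
  simp only [capp, cz, lift2_mk] at h0 hj hjA
  rw [hL, ← Ultrafilter.eventually_not] at hjA
  rw [hL, mk_le, ← Ultrafilter.eventually_or] at h0
  rw [mk_lt] at hj
  have hone : FF (fun _ => 1) := FF.base _ _ hb_succ zz.2
  let g : ℕ → ℕ := fun k => sInf {j | Bad (s.1 k) (c.1 k) (L.1 k) j}
  have hg : FF g := by
    have := FF.base _ _ hb_lb (FF.pair _ _ s.2 (FF.pair _ _ c.2 L.2))
    convert this using 1
    ext k
    simp [g, lb]
  have hbad : ∀ᶠ k in UU, Bad (s.1 k) (c.1 k) (L.1 k) (g k) ∧ g k ≤ j.1 k := by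
    filter_upwards [hj, hjA] with k h1 h2
    have hb : Bad (s.1 k) (c.1 k) (L.1 k) (j.1 k) := ⟨h1, h2⟩
    exact ⟨Nat.sInf_mem (s := {j | Bad (s.1 k) (c.1 k) (L.1 k) j}) ⟨_, hb⟩, Nat.sInf_le hb⟩
  have hpos : ∀ᶠ k in UU, g k - 1 + 1 = g k := by
    filter_upwards [h0, hbad] with k h1 h2
    have : g k ≠ 0 := by
      intro e
      rw [e] at h2
      rcases h1 with h | h
      · exact absurd h2.1.1 (not_lt.2 h)
      · exact h2.1.2 h
    omega
  have hsucc : csucc (mk ⟨_, FF.two hb_sub hg hone⟩) = mk ⟨g, hg⟩ := by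
    rw [csucc, lift1_mk, mk_eq]
    exact hpos
  refine ⟨mk ⟨_, FF.two hb_sub hg hone⟩, ?_, ?_, ?_, ?_⟩
  · rw [hsucc, mk_le]
    filter_upwards [hbad] with k hk using hk.2
  · rw [capp, lift2_mk, hL, mk_le, ← Ultrafilter.eventually_or]
    filter_upwards [hpos] with k hk
    have hn : ¬ Bad (s.1 k) (c.1 k) (L.1 k) (g k - 1) := by
      have hlt : g k - 1 < g k := by omega
      exact Nat.notMem_of_lt_sInf (s := {j | Bad (s.1 k) (c.1 k) (L.1 k) j}) hlt
    unfold Bad at hn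
    show sapp (s.1 k) (g k - 1) ≤ c.1 k ∨ sapp (s.1 k) (g k - 1) ∈ _
    by_contra! hcon
    exact hn ⟨hcon.1, hcon.2⟩
  · rw [hsucc, capp, lift2_mk, mk_lt]
    filter_upwards [hbad] with k hk using hk.1.1
  · rw [hsucc, capp, lift2_mk, hL, ← Ultrafilter.eventually_not]
    filter_upwards [hbad] with k hk using hk.1.2

/-! ### Forcing -/

/-- Forcing conditions: finitely many elements decided to be in, resp. out of, `T`;
standard elements are always in. -/
structure Cond where
  A : List MM
  B : List MM
  dis : ∀ x ∈ B, x ∉ A ∧ ¬ Std x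

instance : Preorder Cond where
  le p q := p.A ⊆ q.A ∧ p.B ⊆ q.B
  le_refl p := ⟨List.Subset.refl _, List.Subset.refl _⟩
  le_trans p q r h1 h2 := ⟨List.Subset.trans h1.1 h2.1, List.Subset.trans h1.2 h2.2⟩

def DS (s : MM) (p : Cond) : Prop :=
  capp s cz ∈ p.B ∨ (∀ j, j < clh s → Std (capp s j) ∨ capp s j ∈ p.A) ∨
    ∃ i, csucc i < clh s ∧ (Std (capp s i) ∨ capp s i ∈ p.A) ∧ capp s (csucc i) ∈ p.B

def DE (d : MM) (p : Cond) : Prop := ¬ Std d → ∃ b ∈ p.B, b < d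

theorem exists_below (l : List MM) (h : ∀ x ∈ l, ¬ Std x) : ∃ c, ¬ Std c ∧ ∀ x ∈ l, c < x := by
  induction l with
  | nil => obtain ⟨c, hc⟩ := exists_nonstd; exact ⟨c, hc, by simp⟩
  | cons a l ih =>
    obtain ⟨c, hc, hl⟩ := ih fun x hx => h x (List.mem_cons_of_mem _ hx)
    have hm : ¬ Std (min a c) := by
      rcases min_choice a c with e | e <;> rw [e]
      · exact h a List.mem_cons_self
      · exact hc
    obtain ⟨y, hy, hlt⟩ := nonstd_pred hm
    refine ⟨y, hy, fun x hx => ?_⟩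
    rcases List.mem_cons.1 hx with rfl | hx
    · exact hlt.trans_le (min_le_left _ _)
    · exact (hlt.trans_le (min_le_right _ _)).trans (hl x hx)

theorem DS_dense (s : MM) : IsCofinal {p | DS s p} := by
  intro p
  by_cases h0 : Std (capp s cz) ∨ capp s cz ∈ p.A
  · by_cases hall : ∀ j, j < clh s → Std (capp s j) ∨ capp s j ∈ p.A
    · exact ⟨p, Or.inr (Or.inl hall), le_refl p⟩
    · push Not at hall
      obtain ⟨j, hjl, hj, hjA⟩ := hall
      obtain ⟨c, hc, hcl⟩ := exists_below (capp s j :: p.B) (by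
        intro x hx
        rcases List.mem_cons.1 hx with rfl | hx
        · exact hj
        · exact (p.dis x hx).2)
      obtain ⟨i, hij, hi, hi1, hi2⟩ := key_step s c p.A j
        (h0.imp (fun h => (std_le_of_not h hc).le) id) (hcl _ List.mem_cons_self) hjA
      refine ⟨⟨capp s i :: p.A, capp s (csucc i) :: p.B, ?_⟩,
        Or.inr (Or.inr ⟨i, hij.trans_lt hjl, Or.inr List.mem_cons_self, List.mem_cons_self⟩),
        List.subset_cons_self _ _, List.subset_cons_self _ _⟩
      intro x hx
      rcases List.mem_cons.1 hx with rfl | hx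
      · refine ⟨?_, fun h => hc (std_down h hi1.le)⟩
        intro hm
        rcases List.mem_cons.1 hm with e | hm
        · rcases hi with h | h
          · rw [e] at hi1; exact absurd hi1 (not_lt.2 h)
          · rw [e] at hi2; exact hi2 h
        · exact hi2 hm
      · refine ⟨?_, (p.dis x hx).2⟩
        intro hm
        rcases List.mem_cons.1 hm with e | hm
        · have hcx := hcl x (List.mem_cons_of_mem _ hx)
          rcases hi with h | h
          · rw [e] at hcx; exact absurd hcx (not_lt.2 h)
          · rw [← e] at h; exact (p.dis x hx).1 h
        · exact (p.dis x hx).1 hm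
  · push Not at h0
    refine ⟨⟨p.A, capp s cz :: p.B, ?_⟩, Or.inl List.mem_cons_self,
      List.Subset.refl _, List.subset_cons_self _ _⟩
    intro x hx
    rcases List.mem_cons.1 hx with rfl | hx
    · exact ⟨h0.2, h0.1⟩
    · exact p.dis x hx

theorem exists_below_not (l : List MM) (d : MM) (hd : ¬ Std d) : ∃ c, ¬ Std c ∧ c < d ∧ c ∉ l := by
  classical
  obtain ⟨c, hc, hl⟩ := exists_below (d :: l.filter (fun x => ¬ Std x)) (by
    intro x hx
    rcases List.mem_cons.1 hx with rfl | hx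
    · exact hd
    · simpa using (List.mem_filter.1 hx).2)
  refine ⟨c, hc, hl d List.mem_cons_self, fun hm => ?_⟩
  exact lt_irrefl c (hl c (List.mem_cons_of_mem _ (List.mem_filter.2 ⟨hm, by simpa using hc⟩)))

theorem DE_dense (d : MM) : IsCofinal {p | DE d p} := by
  intro p
  by_cases hd : Std d
  · exact ⟨p, fun h => absurd hd h, le_refl p⟩
  · obtain ⟨c, hc, hlt, hA⟩ := exists_below_not p.A d hd
    refine ⟨⟨p.A, c :: p.B, ?_⟩, fun _ => ⟨c, List.mem_cons_self, hlt⟩,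
      List.Subset.refl _, List.subset_cons_self _ _⟩
    intro x hx
    rcases List.mem_cons.1 hx with rfl | hx
    · exact ⟨hA, hc⟩
    · exact p.dis x hx

theorem generic : ∃ T : MM → Prop, (∀ x, Std x → T x) ∧
    (∀ s, ∃ p, DS s p ∧ (∀ x ∈ p.A, T x) ∧ ∀ x ∈ p.B, ¬ T x) ∧
    (∀ d, ∃ p, DE d p ∧ (∀ x ∈ p.A, T x) ∧ ∀ x ∈ p.B, ¬ T x) := by
  have : Encodable (MM ⊕ MM) := Encodable.ofCountable _
  let D : MM ⊕ MM → Order.Cofinal Cond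
    | .inl s => ⟨_, DS_dense s⟩
    | .inr d => ⟨_, DE_dense d⟩
  let p0 : Cond := ⟨[], [], by simp⟩
  let I := Order.idealOfCofinals p0 D
  let T : MM → Prop := fun x => Std x ∨ ∃ p ∈ I, x ∈ p.A
  have hB : ∀ p ∈ I, ∀ x ∈ p.B, ¬ T x := by
    rintro p hp x hx (h | ⟨q, hq, hxq⟩)
    · exact (p.dis x hx).2 h
    · obtain ⟨r, _, hpr, hqr⟩ := I.directed p hp q hq
      exact (r.dis x (hpr.2 hx)).1 (hqr.1 hxq)
  refine ⟨T, fun x hx => Or.inl hx, fun s => ?_, fun d => ?_⟩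
  · obtain ⟨p, h1, h2⟩ := Order.cofinal_meets_idealOfCofinals p0 D (.inl s)
    exact ⟨p, h1, fun x hx => Or.inr ⟨p, h2, hx⟩, hB p h2⟩
  · obtain ⟨p, h1, h2⟩ := Order.cofinal_meets_idealOfCofinals p0 D (.inr d)
    exact ⟨p, h1, fun x hx => Or.inr ⟨p, h2, hx⟩, hB p h2⟩

/-- Theorem (Statement 12): there are a countable nonstandard model of PA and a
predicate `T` satisfying SeqInd but not SeqOInd. -/
theorem seqInd_not_implies_seqOInd :
    ∃ (N : PAStruct) (C : Coding N) (T : N.M → Prop),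
      N.ModelOfPA ∧ Countable N.M ∧ (∃ a, N.Nonstd a) ∧
      SeqInd N C T ∧ ¬ SeqOInd N C T := by
  obtain ⟨T, hstd, hS, hE⟩ := generic
  obtain ⟨d, hd⟩ := exists_nonstd
  refine ⟨NN, CC, T, NN_PA, inferInstanceAs (Countable MM), ⟨d, fun n hn => hd ⟨n, hn⟩⟩, ?_, ?_⟩
  · intro s _ h0 hstep j hj
    obtain ⟨p, hp, hA, hB⟩ := hS s
    rcases hp with h | h | ⟨i, hi, h1, h2⟩
    · exact absurd h0 (hB _ h)
    · rcases h j ((NN_lt _ _).1 hj) with h | h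
      · exact hstd _ h
      · exact hA _ h
    · refine absurd (hstep i ((NN_lt _ _).2 hi) ?_) (hB _ h2)
      rcases h1 with h | h
      · exact hstd _ h
      · exact hA _ h
  · intro hO
    obtain ⟨f, rfl⟩ := mk_surj d
    let s : MM := lift1 sid hb_sid (mk f)
    have hlh : clh s = mk f := by
      show clh (lift1 sid hb_sid (mk f)) = mk f
      rw [clh, lift1_mk, lift1_mk, mk_eq]
      exact Eventually.of_forall fun k => sid_lh _
    have happ : ∀ i, i < mk f → capp s i = i := by
      intro i hi
      obtain ⟨g, rfl⟩ := mk_surj i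
      rw [mk_lt] at hi
      show capp (lift1 sid hb_sid (mk f)) (mk g) = mk g
      rw [capp, lift1_mk, lift2_mk, mk_eq]
      filter_upwards [hi] with k hk
      exact sid_app _ _ hk
    have hall := hO s trivial (by
      intro j hj hlt
      have hj : j < clh s := (NN_lt _ _).1 hj
      rw [hlh] at hj
      show T (capp s j)
      rw [happ j hj]
      by_contra hT
      have hns : ¬ Std j := fun h => hT (hstd j h)
      obtain ⟨p, hp, -, hB⟩ := hE j
      obtain ⟨b, hb, hbj⟩ := hp hns
      have hTb : T (capp s b) := hlt b ((NN_lt _ _).2 hbj)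
      rw [happ b (hbj.trans hj)] at hTb
      exact hB b hb hTb)
    obtain ⟨p, hp, -, hB⟩ := hE (mk f)
    obtain ⟨b, hb, hbd⟩ := hp hd
    have hTb : T (capp s b) := hall b ((NN_lt _ _).2 (show b < clh s by rw [hlh]; exact hbd))
    rw [happ b hbd] at hTb
    exact hB b hb hTb

end CTPaper
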